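/- arXiv:1103.2498 — 8 statements merged into one kernel-verified Lean document; each statement's English description precedes it below -/
import Mathlib

section
/- Let τ>0, k₁,k₂∈ℝ, and let z₀∈C¹([−τ,0];ℝ). If z:[−τ,∞)→ℝ is continuous, equals z₀ on [−τ,0], is differentiable on (0,∞), and satisfies z'(t)+k₁z(t)=k₂z(t−τ) for all t>0, then for every t≥0 one has z(t)=e^{−k₁(t+τ)} e_τ^{k̄₂t} z₀(−τ) + ∫_{−τ}^{0} e^{−k₁(t−s)} e_τ^{k̄₂(t−τ−s)} [z₀'(s)+k₁z₀(s)] ds, where k̄₂:=k₂e^{k₁τ}. -/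
open MeasureTheory Real Set Filter Asymptotics

noncomputable section

abbrev Rn (n : ℕ) := EuclideanSpace ℝ (Fin n)

/-- The delayed exponential function `e_τ^{kt}`: it equals `0` for `t < -τ`,
and `∑_{j=0}^{m} k^j (t-(j-1)τ)^j / j!` for `(m-1)τ ≤ t < mτ` (where for
`t ≥ -τ` one has `m = ⌊t/τ⌋ + 1`). -/
noncomputable def delayedExp (τ k t : ℝ) : ℝ :=
  if t < -τ then 0
  else ∑ j ∈ Finset.range (⌊t / τ⌋ + 2).toNat,
      k ^ j * (t - ((j : ℝ) - 1) * τ) ^ j / (Nat.factorial j : ℝ)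

/-- Fourier transform of a real kernel on ℝⁿ: `Ĵ(η) = ∫ e^{-i y·η} J(y) dy`. -/
noncomputable def FT {n : ℕ} (J : Rn n → ℝ) (η : Rn n) : ℂ :=
  ∫ y, Complex.exp (-Complex.I * ((inner ℝ y η : ℝ) : ℂ)) * (J y : ℂ)

/-- The n-dimensional heat kernel `f_β(y) = (4πβ)^{-n/2} e^{-|y|²/(4β)}`. -/
noncomputable def heatKernel (n : ℕ) (β : ℝ) (y : Rn n) : ℝ :=
  (4 * Real.pi * β) ^ (-(n : ℝ) / 2) * Real.exp (-‖y‖ ^ 2 / (4 * β))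

/-- The one-dimensional heat kernel `f_{1β}`. -/
noncomputable def heatKernel1 (β : ℝ) (y : ℝ) : ℝ :=
  (4 * Real.pi * β) ^ (-(1 : ℝ) / 2) * Real.exp (-y ^ 2 / (4 * β))

/-- Partial derivative in the `i`-th coordinate direction. -/
noncomputable def pd {n : ℕ} (i : Fin n) (f : Rn n → ℝ) : Rn n → ℝ :=
  fun x => fderiv ℝ f x (EuclideanSpace.single i 1)

/-- Multi-index partial derivative `∂^j_x`. -/
noncomputable def mpd {n : ℕ} (j : Fin n → ℕ) (f : Rn n → ℝ) : Rn n → ℝ :=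
  ((List.ofFn fun i : Fin n => (pd i)^[j i]).foldr (· ∘ ·) id) f

/-- Square of the (unweighted) Sobolev `H^m` norm:
`∑_{|j| ≤ m} ∫ |∂^j f|²`. -/
noncomputable def HSobSq {n : ℕ} (m : ℕ) (f : Rn n → ℝ) : ℝ :=
  ∑ j ∈ Finset.univ.filter (fun j : Fin n → Fin (m + 1) => (∑ i, (j i : ℕ)) ≤ m),
    ∫ x, (mpd (fun i => (j i : ℕ)) f x) ^ 2

/-- Square of the weighted Sobolev `H^m_w` norm, with a weight depending on the
first coordinate: `∑_{|j| ≤ m} ∫ w(x₁) |∂^j f|²`. -/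
noncomputable def HSobSqW {n : ℕ} [NeZero n] (w : ℝ → ℝ) (m : ℕ) (f : Rn n → ℝ) : ℝ :=
  ∑ j ∈ Finset.univ.filter (fun j : Fin n → Fin (m + 1) => (∑ i, (j i : ℕ)) ≤ m),
    ∫ x, w (x 0) * (mpd (fun i => (j i : ℕ)) f x) ^ 2

/-- The weight function `w(x₁) = e^{-λ*(x₁-x*)}` for `x₁ ≤ x*`, `= 1` for `x₁ > x*`. -/
noncomputable def wgt (lamstar xstar x1 : ℝ) : ℝ :=
  if x1 ≤ xstar then Real.exp (-lamstar * (x1 - xstar)) else 1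


def dG (τ : ℝ) (j : ℕ) (u : ℝ) : ℝ :=
  if u < ((j : ℝ) - 1) * τ then 0 else (u - ((j : ℝ) - 1) * τ) ^ j / (Nat.factorial j : ℝ)

lemma delayedExp_eq_sum (τ k u : ℝ) (hτ : 0 < τ) (N : ℕ) (hN : u < ((N : ℝ) - 1) * τ) :
    delayedExp τ k u = ∑ j ∈ Finset.range N, k ^ j * dG τ j u := by
  unfold delayedExp
  split_ifs with h
  · symm
    apply Finset.sum_eq_zero
    intro j _
    have : u < ((j : ℝ) - 1) * τ := by
      have : (0:ℝ) ≤ j * τ := by positivity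
      nlinarith
    simp [dG, this]
  · push Not at h
    have hfl : -1 ≤ ⌊u / τ⌋ := by
      rw [Int.le_floor, le_div_iff₀ hτ]; push_cast; linarith
    have hlt : ⌊u / τ⌋ < (N : ℤ) - 1 := by
      rw [Int.floor_lt, div_lt_iff₀ hτ]; push_cast; linarith
    have hsub : Finset.range (⌊u / τ⌋ + 2).toNat ⊆ Finset.range N := by
      intro j hj
      simp only [Finset.mem_range] at hj ⊢
      omega
    rw [← Finset.sum_subset hsub]
    · apply Finset.sum_congr rfl
      intro j hj
      simp only [Finset.mem_range] at hj
      have h1 : (j : ℤ) - 1 ≤ ⌊u / τ⌋ := by omega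
      rw [Int.le_floor, le_div_iff₀ hτ] at h1
      push_cast at h1
      rw [dG, if_neg (not_lt.mpr h1)]
      ring
    · intro j _ hj
      simp only [Finset.mem_range] at hj
      have h1 : ⌊u / τ⌋ < (j : ℤ) - 1 := by omega
      rw [Int.floor_lt, div_lt_iff₀ hτ] at h1
      push_cast at h1
      simp [dG, h1]

lemma dG_cont (τ : ℝ) (j : ℕ) : ContinuousOn (dG τ j) (Set.Ici (-τ)) := by
  cases j with
  | zero =>
    apply (continuousOn_const (c := (1:ℝ))).congr
    intro u hu
    have : ¬ (u < -τ) := not_lt.mpr hu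
    simp [dG, this]
  | succ j =>
    have : dG τ (j+1) = fun u => (max 0 (u - (((j+1 : ℕ) : ℝ) - 1) * τ)) ^ (j+1) /
        (Nat.factorial (j+1) : ℝ) := by
      funext u
      unfold dG
      split_ifs with h
      · rw [max_eq_left (by linarith)]; simp
      · rw [max_eq_right (by linarith)]
    rw [this]
    fun_prop

lemma dG_deriv_succ (τ : ℝ) (j : ℕ) (u : ℝ) (hu : u ≠ j * τ) :
    HasDerivAt (dG τ (j+1)) (dG τ j (u - τ)) u := by
  rcases lt_or_gt_of_ne hu with h | h
  · have e : dG τ (j+1) =ᶠ[nhds u] fun _ => 0 := by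
      filter_upwards [Iio_mem_nhds h] with x hx
      simp only [Set.mem_Iio] at hx
      simp [dG, hx]
    have v : dG τ j (u - τ) = 0 := by
      rw [dG, if_pos (by linarith)]
    rw [v]
    exact (hasDerivAt_const u (0:ℝ)).congr_of_eventuallyEq e
  · have e : dG τ (j+1) =ᶠ[nhds u] fun x => (x - j * τ) ^ (j+1) / (Nat.factorial (j+1) : ℝ) := by
      filter_upwards [Ioi_mem_nhds h] with x hx
      simp only [Set.mem_Ioi] at hx
      simp [dG, not_lt.mpr hx.le]
    have v : dG τ j (u - τ) = (u - j * τ) ^ j / (Nat.factorial j : ℝ) := by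
      rw [dG, if_neg (by linarith)]
      congr 2; ring
    rw [v]
    have d := ((((hasDerivAt_id u).sub_const ((j:ℝ) * τ)).pow (j+1)).div_const
      (Nat.factorial (j+1) : ℝ)).congr_of_eventuallyEq e
    refine d.congr_deriv ?_
    have : (Nat.factorial j : ℝ) ≠ 0 := by positivity
    rw [Nat.factorial_succ]
    push_cast
    simp
    field_simp

lemma exists_N (τ t : ℝ) (hτ : 0 < τ) : ∃ N : ℕ, t < ((N : ℝ) - 1) * τ := by
  obtain ⟨n, hn⟩ := exists_nat_gt (t / τ)
  refine ⟨n + 1, ?_⟩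
  rw [div_lt_iff₀ hτ] at hn
  push_cast; linarith

lemma delayedExp_cont (τ k t : ℝ) (hτ : 0 < τ) :
    ContinuousOn (delayedExp τ k) (Set.Icc (-τ) t) := by
  obtain ⟨N, hN⟩ := exists_N τ t hτ
  have : ContinuousOn (fun u => ∑ j ∈ Finset.range N, k ^ j * dG τ j u) (Set.Icc (-τ) t) := by
    apply continuousOn_finsetSum
    intro j _
    exact continuousOn_const.mul ((dG_cont τ j).mono Set.Icc_subset_Ici_self)
  apply this.congr
  intro u hu
  exact delayedExp_eq_sum τ k u hτ N (by linarith [hu.2])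

lemma delayedExp_deriv (τ k u : ℝ) (hτ : 0 < τ) (hu : -τ < u)
    (hne : ∀ j : ℕ, u ≠ j * τ) :
    HasDerivAt (delayedExp τ k) (k * delayedExp τ k (u - τ)) u := by
  obtain ⟨N, hN⟩ := exists_N τ u hτ
  have e : delayedExp τ k =ᶠ[nhds u]
      fun x => ∑ j ∈ Finset.range N, k ^ (j+1) * dG τ (j+1) x + 1 := by
    filter_upwards [Iio_mem_nhds hN, Ioi_mem_nhds hu] with x hx hx'
    simp only [Set.mem_Iio, Set.mem_Ioi] at hx hx'
    rw [delayedExp_eq_sum τ k x hτ (N+1) (by push_cast; linarith), Finset.sum_range_succ']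
    simp [dG, not_lt.mpr hx'.le]
  rw [delayedExp_eq_sum τ k (u - τ) hτ N (by linarith), Finset.mul_sum]
  refine HasDerivAt.congr_of_eventuallyEq ?_ e
  apply HasDerivAt.add_const
  have := HasDerivAt.fun_sum (u := Finset.range N) (x := u)
    (A := fun j x => k ^ (j+1) * dG τ (j+1) x)
    (A' := fun j => k ^ (j+1) * dG τ j (u - τ))
    (fun j _ => (dG_deriv_succ τ j u (hne j)).const_mul _)
  convert this using 1
  apply Finset.sum_congr rfl
  intro j _
  ring

lemma delayedExp_neg (τ k : ℝ) (hτ : 0 < τ) : delayedExp τ k (-τ) = 1 := by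
  have : -τ / τ = -1 := by field_simp
  simp [delayedExp, this]
  have : (⌊(-1:ℝ)⌋ + 2).toNat = 1 := by
    have : ⌊(-1:ℝ)⌋ = -1 := by exact_mod_cast Int.floor_intCast (R := ℝ) (-1)
    rw [this]; rfl
  norm_num

lemma ii_congr {f g : ℝ → ℝ} {a b : ℝ} (h : Set.EqOn f g (Set.uIoc a b)) :
    ∫ x in a..b, f x = ∫ x in a..b, g x :=
  intervalIntegral.integral_congr_ae (Filter.Eventually.of_forall h)

/-- the core formula for `y' = K y(·-τ)` -/
lemma core (τ K t : ℝ) (hτ : 0 < τ) (ht : 0 ≤ t) (y w : ℝ → ℝ)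
    (hy : ContinuousOn y (Set.Ici (-τ)))
    (hw : ContinuousOn w (Set.Icc (-τ) 0))
    (hd0 : ∀ s ∈ Set.Ioo (-τ) 0, HasDerivAt y (w s) s)
    (hd1 : ∀ s > 0, HasDerivAt y (K * y (s - τ)) s) :
    y t = delayedExp τ K t * y (-τ) + ∫ s in (-τ)..0, delayedExp τ K (t - τ - s) * w s := by
  set E := delayedExp τ K with hE
  have hEc : ContinuousOn (fun s => E (t - τ - s)) (Set.Icc (-τ) t) := by
    apply (delayedExp_cont τ K t hτ).comp (by fun_prop)
    intro s hs
    constructor <;> linarith [hs.1, hs.2]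
  let yd : ℝ → ℝ := fun s => if s ≤ 0 then w s else K * y (s - τ)
  let f : ℝ → ℝ := fun s => K * E (t - τ - s - τ) * y s
  have c0 : Set.EqOn (fun s => E (t - τ - s) * w s) (fun s => E (t - τ - s) * yd s)
      (Set.uIoc (-τ) 0) := by
    intro s hs
    rw [Set.uIoc_of_le (by linarith)] at hs
    simp [yd, hs.2]
  have c1 : Set.EqOn (fun s => f (s - τ)) (fun s => E (t - τ - s) * yd s)
      (Set.uIoc 0 t) := by
    intro s hs
    rw [Set.uIoc_of_le ht] at hs
    simp only [yd, f, not_le.mpr hs.1, if_false]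
    rw [show t - τ - (s - τ) - τ = t - τ - s by ring]
    ring
  have c2 : Set.EqOn (fun _ => (0:ℝ)) f (Set.uIoc (t - τ) t) := by
    intro s hs
    rw [Set.uIoc_of_le (by linarith)] at hs
    have : t - τ - s - τ < -τ := by linarith [hs.1]
    simp [f, hE, delayedExp, this]
  have i0 : IntervalIntegrable (fun s => E (t - τ - s) * yd s) volume (-τ) 0 := by
    refine IntervalIntegrable.congr c0 ?_
    apply ContinuousOn.intervalIntegrable
    rw [Set.uIcc_of_le (by linarith)]
    exact (hEc.mono (Set.Icc_subset_Icc_right ht)).mul hw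
  have i1' : IntervalIntegrable (fun s => f (s - τ)) volume 0 t := by
    apply ContinuousOn.intervalIntegrable
    rw [Set.uIcc_of_le ht]
    have a : ContinuousOn (fun s => E (t - τ - s)) (Set.Icc 0 t) :=
      hEc.mono (Set.Icc_subset_Icc_left (by linarith))
    have b : ContinuousOn (fun s => y (s - τ)) (Set.Icc 0 t) := by
      apply hy.comp (by fun_prop)
      intro s hs
      simp only [Set.mem_Ici]; linarith [hs.1]
    apply ((continuousOn_const (c := K)).mul a |>.mul b).congr
    intro s _
    simp only [f]
    rw [show t - τ - (s - τ) - τ = t - τ - s by ring]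
    rfl
  have i1 : IntervalIntegrable (fun s => E (t - τ - s) * yd s) volume 0 t := i1'.congr c1
  have i2 : IntervalIntegrable f volume (-τ) (t - τ) := by
    apply ContinuousOn.intervalIntegrable
    rw [Set.uIcc_of_le (by linarith)]
    have a : ContinuousOn (fun s => E (t - τ - s - τ)) (Set.Icc (-τ) (t-τ)) := by
      apply (delayedExp_cont τ K t hτ).comp (by fun_prop)
      intro s hs
      constructor <;> linarith [hs.1, hs.2]
    exact ((continuousOn_const (c := K)).mul a).mul (hy.mono Set.Icc_subset_Ici_self)
  have i3 : IntervalIntegrable f volume (t - τ) t :=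
    IntervalIntegrable.congr c2 (by simp)
  have ftc := MeasureTheory.integral_eq_of_hasDerivAt_off_countable
    (fun s => E (t - τ - s) * y s) (fun s => E (t - τ - s) * yd s - f s)
    (a := -τ) (b := t) (s := insert 0 (Set.range (fun j : ℕ => t - τ - j * τ)))
    ((Set.countable_range _).insert _)
    (by
      rw [Set.uIcc_of_le (by linarith)]
      exact hEc.mul (hy.mono Set.Icc_subset_Ici_self))
    (by
      rintro s ⟨hs, hsn⟩
      rw [min_eq_left (by linarith), max_eq_right (by linarith)] at hs
      simp only [Set.mem_insert_iff, Set.mem_range, not_or, not_exists] at hsn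
      have d1 : HasDerivAt y (yd s) s := by
        rcases lt_or_gt_of_ne hsn.1 with h | h
        · simp only [yd, h.le, if_true]
          exact hd0 s ⟨hs.1, h⟩
        · simp only [yd, not_le.mpr h, if_false]
          exact hd1 s h
      have d2 : HasDerivAt E (K * E (t - τ - s - τ)) (t - τ - s) := by
        apply delayedExp_deriv τ K _ hτ (by linarith [hs.2])
        intro j hj
        exact hsn.2 j (by linarith)
      have d3 := (d2.comp_const_sub (t - τ) s).mul d1
      refine d3.congr_deriv ?_
      simp only [f]; ring)
    ((i0.trans i1).sub (i2.trans i3))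
  rw [intervalIntegral.integral_sub (i0.trans i1) (i2.trans i3),
    ← intervalIntegral.integral_add_adjacent_intervals i0 i1,
    ← intervalIntegral.integral_add_adjacent_intervals i2 i3,
    ← ii_congr c0, ← ii_congr c1,
    ← ii_congr c2, intervalIntegral.integral_comp_sub_right] at ftc
  have e1 : E (t - τ - t) = 1 := by
    rw [show t - τ - t = -τ by ring]; exact delayedExp_neg τ K hτ
  rw [e1, show t - τ - -τ = t by ring] at ftc
  simp only [zero_sub, intervalIntegral.integral_zero] at ftc
  linarith

/-- solution formula for the linear delayed ODE
`z'(t) + k₁ z(t) = k₂ z(t-τ)`. -/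
theorem linear_delayed_ode_solution_formula
    (τ k₁ k₂ : ℝ) (hτ : 0 < τ)
    (z z₀ z₀' : ℝ → ℝ)
    (hz₀C1 : ∀ s ∈ Set.Icc (-τ) 0, HasDerivAt z₀ (z₀' s) s)
    (hz₀C1cont : ContinuousOn z₀' (Set.Icc (-τ) 0))
    (hzcont : ContinuousOn z (Set.Ici (-τ)))
    (hinit : ∀ s ∈ Set.Icc (-τ) 0, z s = z₀ s)
    (hode : ∀ t > (0 : ℝ), HasDerivAt z (k₂ * z (t - τ) - k₁ * z t) t) :
    ∀ t ≥ (0 : ℝ),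
      z t = Real.exp (-k₁ * (t + τ)) * delayedExp τ (k₂ * Real.exp (k₁ * τ)) t * z₀ (-τ)
        + ∫ s in (-τ)..0,
            Real.exp (-k₁ * (t - s)) * delayedExp τ (k₂ * Real.exp (k₁ * τ)) (t - τ - s)
              * (z₀' s + k₁ * z₀ s) := by
  intro t ht
  have hexp : ∀ s : ℝ, HasDerivAt (fun s => Real.exp (k₁ * s)) (Real.exp (k₁ * s) * k₁) s := by
    intro s
    simpa using ((hasDerivAt_id s).const_mul k₁).exp
  have hz₀c : ContinuousOn z₀ (Set.Icc (-τ) 0) :=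
    fun s hs => (hz₀C1 s hs).continuousAt.continuousWithinAt
  have key := core τ (k₂ * Real.exp (k₁ * τ)) t hτ ht (fun s => Real.exp (k₁ * s) * z s)
    (fun s => Real.exp (k₁ * s) * (z₀' s + k₁ * z₀ s))
    (ContinuousOn.mul (by fun_prop) hzcont)
    (ContinuousOn.mul (by fun_prop) (hz₀C1cont.add (continuousOn_const.mul hz₀c)))
    (by
      intro s hs
      have e : z =ᶠ[nhds s] z₀ := by
        filter_upwards [Ioo_mem_nhds hs.1 hs.2] with x hx
        exact hinit x ⟨hx.1.le, hx.2.le⟩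
      have hs' : s ∈ Set.Icc (-τ) 0 := ⟨hs.1.le, hs.2.le⟩
      have d := (hexp s).mul ((hz₀C1 s hs').congr_of_eventuallyEq e)
      refine d.congr_deriv ?_
      rw [hinit s hs']; ring)
    (by
      intro s hs
      have d := (hexp s).mul (hode s hs)
      refine d.congr_deriv ?_
      have : Real.exp (k₁ * s) = Real.exp (k₁ * τ) * Real.exp (k₁ * (s - τ)) := by
        rw [← Real.exp_add]; congr 1; ring
      rw [this]; ring)
  have h1 : z t = Real.exp (-k₁ * t) * (Real.exp (k₁ * t) * z t) := by
    rw [← mul_assoc, ← Real.exp_add]; simp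
  rw [h1, key, mul_add, ← intervalIntegral.integral_const_mul,
    hinit (-τ) ⟨le_rfl, by linarith⟩]
  congr 1
  · rw [show -k₁ * (t + τ) = -k₁ * t + k₁ * (-τ) by ring, Real.exp_add]; ring
  · apply intervalIntegral.integral_congr
    intro s _
    simp only
    rw [show -k₁ * (t - s) = -k₁ * t + k₁ * s by ring, Real.exp_add]; ring

end
end

section
/- Let τ>0 and k̄∈ℝ. The function z(t)=e_τ^{k̄t} is continuous on [−τ,∞), equals 1 identically on [−τ,0], is differentiable at every t>0, and satisfies z'(t)=k̄ z(t−τ) for all t>0; that is, the delayed exponential is the fundamental solution of the pure delay equation z'(t)=k̄z(t−τ) with unit initial data on [−τ,0]. -/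
open MeasureTheory Real Set Filter Asymptotics

noncomputable section

theorem dexp_aux_eq (τ k : ℝ) (hτ : 0 < τ) (t : ℝ) (ht : -τ ≤ t) (N : ℕ) (hN : t < ((N:ℝ) - 1) * τ) :
    delayedExp τ k t = ∑ j ∈ Finset.range N,
      k ^ j * (max (t - ((j : ℝ) - 1) * τ) 0) ^ j / (Nat.factorial j : ℝ) := by
  unfold delayedExp
  rw [if_neg (not_lt.mpr ht)]
  have hfl : -1 ≤ ⌊t / τ⌋ := by
    rw [Int.le_floor, le_div_iff₀ hτ]; push_cast; linarith
  have hfN : ⌊t / τ⌋ < (N:ℤ) - 1 := by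
    rw [Int.floor_lt, div_lt_iff₀ hτ]; push_cast; exact hN
  have hsub : Finset.range (⌊t / τ⌋ + 2).toNat ⊆ Finset.range N := by
    intro j hj
    simp only [Finset.mem_range] at hj ⊢
    omega
  rw [← Finset.sum_subset hsub]
  · apply Finset.sum_congr rfl
    intro j hj
    simp only [Finset.mem_range] at hj
    have h1 : (j:ℤ) - 1 ≤ ⌊t / τ⌋ := by omega
    rw [Int.le_floor, le_div_iff₀ hτ] at h1
    push_cast at h1
    rw [max_eq_left (by linarith)]
  · intro j _ hj
    simp only [Finset.mem_range, not_lt] at hj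
    have h1 : ⌊t / τ⌋ < (j:ℤ) - 1 := by omega
    have h0 : j ≠ 0 := by omega
    rw [Int.floor_lt, div_lt_iff₀ hτ] at h1
    push_cast at h1
    rw [max_eq_right (by linarith), zero_pow h0]
    simp

theorem max_pow_hasDerivAt_ne (n : ℕ) (x : ℝ) (hx : x ≠ 0) :
    HasDerivAt (fun y : ℝ => (max y 0) ^ (n + 1)) (((n:ℝ) + 1) * (if x < 0 then 0 else (max x 0) ^ n)) x := by
  rcases lt_or_gt_of_ne hx with h | h
  · rw [if_pos h, mul_zero]
    refine (hasDerivAt_const x (0:ℝ)).congr_of_eventuallyEq ?_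
    filter_upwards [Iio_mem_nhds h] with y hy
    rw [max_eq_right (le_of_lt hy)]; simp
  · rw [if_neg (not_lt.mpr h.le), max_eq_left h.le]
    have := hasDerivAt_pow (n + 1) x
    simp only [Nat.add_sub_cancel, Nat.cast_add, Nat.cast_one] at this
    refine this.congr_of_eventuallyEq ?_
    filter_upwards [Ioi_mem_nhds h] with y hy
    rw [max_eq_left (le_of_lt hy)]

theorem max_pow_hasDerivAt (n : ℕ) (x : ℝ) (hx : n ≠ 0 ∨ 0 < x) :
    HasDerivAt (fun y : ℝ => (max y 0) ^ (n + 1)) (((n:ℝ) + 1) * (max x 0) ^ n) x := by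
  rcases hx with hn | hx
  · have key : ∀ y : ℝ, y ≠ 0 →
        HasDerivAt (fun y : ℝ => (max y 0) ^ (n + 1)) (((n:ℝ) + 1) * (max y 0) ^ n) y := by
      intro y hy
      have := max_pow_hasDerivAt_ne n y hy
      split_ifs at this with h
      · rw [max_eq_right h.le, zero_pow hn]; exact this
      · exact this
    by_cases h0 : x = 0
    · subst h0
      refine hasDerivAt_of_hasDerivAt_of_ne (f := fun y : ℝ => (max y 0) ^ (n + 1))
        (g := fun y => ((n:ℝ) + 1) * (max y 0) ^ n) key ?_ ?_
      · exact Continuous.continuousAt (by fun_prop)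
      · exact Continuous.continuousAt (by fun_prop)
    · exact key x h0
  · have := max_pow_hasDerivAt_ne n x hx.ne'
    rwa [if_neg (not_lt.mpr hx.le)] at this

theorem exists_dexp_bound (τ : ℝ) (hτ : 0 < τ) (t : ℝ) : ∃ N : ℕ, t < (N:ℝ) * τ := by
  obtain ⟨N, hN⟩ := exists_nat_gt (t / τ)
  exact ⟨N, (div_lt_iff₀ hτ).mp hN⟩

/-- the delayed exponential `e_τ^{k̄t}` is the fundamental solution of the
pure delay equation `z'(t) = k̄ z(t-τ)` with unit initial data on `[-τ,0]`. -/
theorem delayedExp_fundamental_solution (τ kbar : ℝ) (hτ : 0 < τ) :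
    ContinuousOn (delayedExp τ kbar) (Set.Ici (-τ)) ∧
    (∀ t ∈ Set.Icc (-τ) (0 : ℝ), delayedExp τ kbar t = 1) ∧
    (∀ t > (0 : ℝ),
      HasDerivAt (delayedExp τ kbar) (kbar * delayedExp τ kbar (t - τ)) t) := by
  refine ⟨?_, ?_, ?_⟩
  · intro t ht
    obtain ⟨N, hN⟩ := exists_dexp_bound τ hτ t
    have hc : Continuous (fun s : ℝ => ∑ j ∈ Finset.range (N + 1),
      kbar ^ j * (max (s - ((j : ℝ) - 1) * τ) 0) ^ j / (Nat.factorial j : ℝ)) := by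
      fun_prop
    refine hc.continuousWithinAt.congr_of_eventuallyEq ?_ ?_
    · filter_upwards [self_mem_nhdsWithin, mem_nhdsWithin_of_mem_nhds (Iio_mem_nhds hN)] with s hs hs'
      exact dexp_aux_eq τ kbar hτ s hs (N + 1) (by push_cast; simpa using hs')
    · exact dexp_aux_eq τ kbar hτ t ht (N + 1) (by push_cast; simpa using hN)
  · intro t ht
    rw [dexp_aux_eq τ kbar hτ t ht.1 2 (by push_cast; linarith [ht.2])]
    simp [Finset.sum_range_succ, ht.2]
  · intro t ht
    obtain ⟨N, hN⟩ := exists_dexp_bound τ hτ t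
    have hE : delayedExp τ kbar =ᶠ[nhds t] (fun s : ℝ => ∑ j ∈ Finset.range (N + 1),
      kbar ^ j * (max (s - ((j : ℝ) - 1) * τ) 0) ^ j / (Nat.factorial j : ℝ)) := by
      filter_upwards [Ioi_mem_nhds ht, Iio_mem_nhds hN] with s hs hs'
      have hs0 : 0 < s := hs
      exact dexp_aux_eq τ kbar hτ s (by linarith) (N + 1) (by push_cast; simpa using hs')
    refine HasDerivAt.congr_of_eventuallyEq ?_ hE
    rw [dexp_aux_eq τ kbar hτ (t - τ) (by linarith) N (by linarith)]
    simp only [Finset.sum_range_succ']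
    rw [Finset.mul_sum]
    simp only [pow_zero, Nat.factorial_zero, mul_one]
    refine HasDerivAt.add_const _ ?_
    refine HasDerivAt.fun_sum ?_
    intro i _
    have h1 := max_pow_hasDerivAt i (t - (((i + 1 : ℕ) : ℝ) - 1) * τ) (by
      by_cases h : i = 0
      · right; subst h; simpa using ht
      · exact Or.inl h)
    have h2 := h1.comp t ((hasDerivAt_id t).sub_const ((((i + 1 : ℕ) : ℝ) - 1) * τ))
    have h3 := (h2.const_mul (kbar ^ (i + 1))).div_const (((i + 1).factorial : ℕ) : ℝ)
    refine HasDerivAt.congr_deriv h3 ?_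
    have e : t - τ - ((i:ℝ) - 1) * τ = t - (((i + 1 : ℕ) : ℝ) - 1) * τ := by push_cast; ring
    rw [e, Nat.factorial_succ]
    have hf : (i.factorial : ℝ) ≠ 0 := by positivity
    have hi : (i:ℝ) + 1 ≠ 0 := by positivity
    push_cast
    field_simp
    ring

end
end

section
/- Let τ>0, k₁≥0, k₂≥0, and let z₀∈C¹([−τ,0];ℝ). If z:[−τ,∞)→ℝ is continuous, equals z₀ on [−τ,0], is differentiable on (0,∞), and satisfies z'(t)+k₁z(t)=k₂z(t−τ) for all t>0, then for every t≥0 one has |z(t)| ≤ C₀ e^{−k₁t} e_τ^{k̄₂t}, where k̄₂:=k₂e^{k₁τ} and C₀:= e^{−k₁τ}|z₀(−τ)| + ∫_{−τ}^{0} e^{k₁s}|z₀'(s)+k₁z₀(s)| ds. -/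
open MeasureTheory Real Set Filter Asymptotics

noncomputable section

theorem aux_cmp (a b : ℝ) (f f' g g' : ℝ → ℝ)
    (hf : ContinuousOn f (Set.Icc a b)) (hg : ContinuousOn g (Set.Icc a b))
    (hf' : ∀ x ∈ Set.Ioo a b, HasDerivAt f (f' x) x)
    (hg' : ∀ x ∈ Set.Ioo a b, HasDerivAt g (g' x) x)
    (hle : ∀ x ∈ Set.Ioo a b, |f' x| ≤ g' x) (h0 : |f a| ≤ g a) :
    ∀ x ∈ Set.Icc a b, |f x| ≤ g x := by
  intro x hx
  have ha : a ∈ Set.Icc a b := ⟨le_rfl, hx.1.trans hx.2⟩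
  have h1 : MonotoneOn (fun x => g x - f x) (Set.Icc a b) := by
    apply monotoneOn_of_deriv_nonneg (convex_Icc a b) (hg.sub hf)
    · rw [interior_Icc]
      intro y hy
      exact ((hg' y hy).sub (hf' y hy)).differentiableAt.differentiableWithinAt
    · rw [interior_Icc]
      intro y hy
      have := ((hg' y hy).sub (hf' y hy)).deriv
      rw [this]
      linarith [(abs_le.1 (hle y hy)).2]
  have h2 : MonotoneOn (fun x => g x + f x) (Set.Icc a b) := by
    apply monotoneOn_of_deriv_nonneg (convex_Icc a b) (hg.add hf)
    · rw [interior_Icc]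
      intro y hy
      exact ((hg' y hy).add (hf' y hy)).differentiableAt.differentiableWithinAt
    · rw [interior_Icc]
      intro y hy
      have := ((hg' y hy).add (hf' y hy)).deriv
      rw [this]
      linarith [(abs_le.1 (hle y hy)).1]
  have i1 := h1 ha hx hx.1
  have i2 := h2 ha hx hx.1
  have := abs_le.1 h0
  simp only at i1 i2
  exact abs_le.2 ⟨by linarith, by linarith⟩

def auxS (τ k : ℝ) (m : ℕ) (t : ℝ) : ℝ :=
  ∑ j ∈ Finset.range (m + 1), k ^ j * (t - ((j : ℝ) - 1) * τ) ^ j / (Nat.factorial j : ℝ)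

theorem auxS_deriv (τ k : ℝ) (m : ℕ) (t : ℝ) :
    HasDerivAt (auxS τ k (m + 1)) (k * auxS τ k m (t - τ)) t := by
  have h : ∀ j ∈ Finset.range (m + 1), HasDerivAt
      (fun t : ℝ => k ^ (j + 1) * (t - (((j + 1 : ℕ) : ℝ) - 1) * τ) ^ (j + 1) / (Nat.factorial (j + 1) : ℝ))
      (k * (k ^ j * (t - τ - ((j : ℝ) - 1) * τ) ^ j / (Nat.factorial j : ℝ))) t := by
    intro j _
    have := (((((hasDerivAt_id t).sub_const ((((j + 1 : ℕ) : ℝ) - 1) * τ)).pow (j + 1)).const_mul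
      (k ^ (j + 1))).div_const (Nat.factorial (j + 1) : ℝ))
    refine this.congr_deriv ?_
    have h1 : (Nat.factorial j : ℝ) ≠ 0 := by positivity
    have h2 : ((j : ℝ) + 1) ≠ 0 := by positivity
    have h3 : t - τ - ((j : ℝ) - 1) * τ = t - (((j + 1 : ℕ) : ℝ) - 1) * τ := by push_cast; ring
    rw [h3, Nat.factorial_succ]
    push_cast
    simp only [id]
    field_simp
    ring
  have hs := (HasDerivAt.fun_sum h).add_const 1
  have e : auxS τ k (m + 1) = fun t => (∑ j ∈ Finset.range (m + 1),
      k ^ (j + 1) * (t - (((j + 1 : ℕ) : ℝ) - 1) * τ) ^ (j + 1) / (Nat.factorial (j + 1) : ℝ)) + 1 := by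
    funext t
    unfold auxS
    rw [Finset.sum_range_succ']
    simp
  rw [e]
  refine hs.congr_deriv ?_
  rw [auxS, Finset.mul_sum]

theorem auxS_glue (τ k : ℝ) (m : ℕ) : auxS τ k (m + 1) (m * τ) = auxS τ k m (m * τ) := by
  unfold auxS
  rw [Finset.sum_range_succ _ (m + 1)]
  simp

/-- a priori bound for solutions of the linear delayed ODE
`z'(t) + k₁ z(t) = k₂ z(t-τ)` with `k₁, k₂ ≥ 0`. -/
theorem linear_delayed_ode_bound
    (τ k₁ k₂ : ℝ) (hτ : 0 < τ) (hk₁ : 0 ≤ k₁) (hk₂ : 0 ≤ k₂)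
    (z z₀ z₀' : ℝ → ℝ)
    (hz₀C1 : ∀ s ∈ Set.Icc (-τ) 0, HasDerivAt z₀ (z₀' s) s)
    (hz₀C1cont : ContinuousOn z₀' (Set.Icc (-τ) 0))
    (hzcont : ContinuousOn z (Set.Ici (-τ)))
    (hinit : ∀ s ∈ Set.Icc (-τ) 0, z s = z₀ s)
    (hode : ∀ t > (0 : ℝ), HasDerivAt z (k₂ * z (t - τ) - k₁ * z t) t) :
    ∀ t ≥ (0 : ℝ),
      |z t| ≤ (Real.exp (-k₁ * τ) * |z₀ (-τ)|
          + ∫ s in (-τ)..0, Real.exp (k₁ * s) * |z₀' s + k₁ * z₀ s|)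
        * Real.exp (-k₁ * t) * delayedExp τ (k₂ * Real.exp (k₁ * τ)) t := by
  set C := (Real.exp (-k₁ * τ) * |z₀ (-τ)|
          + ∫ s in (-τ)..0, Real.exp (k₁ * s) * |z₀' s + k₁ * z₀ s|) with hC
  set K := k₂ * Real.exp (k₁ * τ) with hK
  have hK0 : 0 ≤ K := by positivity
  have hexp : ∀ t, HasDerivAt (fun t : ℝ => Real.exp (k₁ * t)) (Real.exp (k₁ * t) * k₁) t := by
    intro t
    simpa using ((hasDerivAt_id t).const_mul k₁).exp
  have hz₀c : ContinuousOn z₀ (Set.Icc (-τ) 0) := fun s hs =>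
    (hz₀C1 s hs).continuousAt.continuousWithinAt
  have hu : ContinuousOn (fun t => Real.exp (k₁ * t) * z t) (Set.Ici (-τ)) :=
    ContinuousOn.mul (by fun_prop) hzcont
  have hw : ContinuousOn (fun s => Real.exp (k₁ * s) * |z₀' s + k₁ * z₀ s|) (Set.Icc (-τ) 0) :=
    ContinuousOn.mul (by fun_prop) (hz₀C1cont.add (continuousOn_const.mul hz₀c)).abs
  have hτ' : -τ ≤ 0 := by linarith
  have hwi : IntervalIntegrable (fun s => Real.exp (k₁ * s) * |z₀' s + k₁ * z₀ s|) volume (-τ) 0 :=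
    ContinuousOn.intervalIntegrable (by rwa [Set.uIcc_of_le hτ'])
  have hbase : ∀ t ∈ Set.Icc (-τ) 0, |Real.exp (k₁ * t) * z t| ≤ C := by
    intro t ht
    rw [hinit t ht]
    have key := aux_cmp (-τ) 0 (fun t => Real.exp (k₁ * t) * z₀ t)
      (fun t => Real.exp (k₁ * t) * k₁ * z₀ t + Real.exp (k₁ * t) * z₀' t)
      (fun t => Real.exp (-k₁ * τ) * |z₀ (-τ)|
          + ∫ s in (-τ)..t, Real.exp (k₁ * s) * |z₀' s + k₁ * z₀ s|)
      (fun s => Real.exp (k₁ * s) * |z₀' s + k₁ * z₀ s|)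
      (ContinuousOn.mul (by fun_prop) hz₀c)
      (continuousOn_const.add (by
        have := intervalIntegral.continuousOn_primitive_interval' hwi (Set.left_mem_uIcc)
        rwa [Set.uIcc_of_le hτ'] at this))
      (fun x hx => (hexp x).mul (hz₀C1 x (Set.Ioo_subset_Icc_self hx)))
      (fun x hx => by
        refine HasDerivAt.const_add _ ?_
        have hn : Set.Icc (-τ) 0 ∈ nhds x := Icc_mem_nhds hx.1 hx.2
        refine intervalIntegral.integral_hasDerivAt_right ?_ ?_ (hw.continuousAt hn)
        · refine hwi.mono_set ?_
          rw [Set.uIcc_of_le hτ', Set.uIcc_of_le hx.1.le]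
          exact Set.Icc_subset_Icc le_rfl hx.2.le
        · exact (hw.mono Set.Ioo_subset_Icc_self).stronglyMeasurableAtFilter isOpen_Ioo x hx)
      (fun x hx => by
        have : Real.exp (k₁ * x) * k₁ * z₀ x + Real.exp (k₁ * x) * z₀' x
          = Real.exp (k₁ * x) * (z₀' x + k₁ * z₀ x) := by ring
        rw [this, abs_mul, abs_of_pos (Real.exp_pos _)])
      (by
        simp only [intervalIntegral.integral_same, add_zero]
        rw [abs_mul, abs_of_pos (Real.exp_pos _)]
        simp) t ht
    refine key.trans ?_
    rw [hC]
    refine add_le_add le_rfl ?_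
    refine intervalIntegral.integral_mono_interval le_rfl ht.1 ht.2 ?_ hwi
    exact Filter.Eventually.of_forall fun s => by positivity
  have hode' : ∀ t > (0 : ℝ), HasDerivAt (fun t => Real.exp (k₁ * t) * z t)
      (K * (Real.exp (k₁ * (t - τ)) * z (t - τ))) t := by
    intro t ht
    refine ((hexp t).mul (hode t ht)).congr_deriv ?_
    have : Real.exp (k₁ * t) = Real.exp (k₁ * τ) * Real.exp (k₁ * (t - τ)) := by
      rw [← Real.exp_add]; ring_nf
    rw [hK, this]; ring
  have hind : ∀ m : ℕ, ∀ t ∈ Set.Icc (((m : ℝ) - 1) * τ) (m * τ),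
      |Real.exp (k₁ * t) * z t| ≤ C * auxS τ K m t := by
    intro m
    induction m with
    | zero =>
      intro t ht
      have : auxS τ K 0 t = 1 := by simp [auxS]
      rw [this, mul_one]
      apply hbase
      simpa using ht
    | succ m ih =>
      have hm : (0 : ℝ) ≤ m * τ := by positivity
      have e1 : (((m + 1 : ℕ) : ℝ) - 1) * τ = m * τ := by push_cast; ring
      rw [e1]
      refine aux_cmp _ _ _ (fun t => K * (Real.exp (k₁ * (t - τ)) * z (t - τ))) _
        (fun t => C * (K * auxS τ K m (t - τ)))
        (hu.mono ?_) ?_ ?_ ?_ ?_ ?_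
      · intro x hx
        exact le_trans (by linarith) hx.1
      · exact fun x _ => ((auxS_deriv τ K m x).const_mul C).continuousAt.continuousWithinAt
      · exact fun x hx => hode' x (lt_of_le_of_lt hm hx.1)
      · exact fun x _ => (auxS_deriv τ K m x).const_mul C
      · intro x hx
        have h1 := hx.1
        have h2 := hx.2
        push_cast at h2
        have := ih (x - τ) ⟨by linarith, by linarith⟩
        rw [abs_mul, abs_of_nonneg hK0]
        calc _ ≤ K * (C * auxS τ K m (x - τ)) := mul_le_mul_of_nonneg_left this hK0
          _ = _ := by ring
      · rw [auxS_glue]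
        exact ih _ ⟨by linarith, le_rfl⟩
  intro t ht
  have hfl : 0 ≤ ⌊t / τ⌋ := Int.floor_nonneg.2 (by positivity)
  obtain ⟨n, hn⟩ := Int.eq_ofNat_of_zero_le hfl
  have hE : delayedExp τ K t = auxS τ K (n + 1) t := by
    unfold delayedExp auxS
    rw [if_neg (by linarith), hn]
    rfl
  have hl := Int.floor_le (t / τ)
  have hr := Int.lt_floor_add_one (t / τ)
  rw [hn] at hl hr
  rw [le_div_iff₀ hτ] at hl
  rw [div_lt_iff₀ hτ] at hr
  push_cast at hl hr
  have := hind (n + 1) t ⟨by push_cast; linarith, by push_cast; linarith⟩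
  rw [abs_mul, abs_of_pos (Real.exp_pos _)] at this
  rw [hE]
  have hx : Real.exp (-k₁ * t) * Real.exp (k₁ * t) = 1 := by
    rw [← Real.exp_add]; simp
  calc |z t| = Real.exp (-k₁ * t) * (Real.exp (k₁ * t) * |z t|) := by rw [← mul_assoc, hx, one_mul]
    _ ≤ Real.exp (-k₁ * t) * (C * auxS τ K (n + 1) t) :=
      mul_le_mul_of_nonneg_left this (Real.exp_pos _).le
    _ = _ := by ring


end
end

section
/- Let τ>0, k̄>0 and let γ>0 be arbitrary. Then there exists a constant C>0 such that e_τ^{k̄t} ≤ C(1+t)^{−γ} e^{k̄t} for all t>0. -/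
open MeasureTheory Real Set Filter Asymptotics

noncomputable section

lemma exists_rate (τ k : ℝ) (hτ : 0 < τ) (hk : 0 < k) :
    ∃ r, 0 < r ∧ r < k ∧ k * Real.exp (-(r * τ)) / r < 1 := by
  have hcont : ContinuousAt (fun r : ℝ => k * Real.exp (-(r * τ)) / r) k := by
    apply ContinuousAt.div (by fun_prop) (by fun_prop) hk.ne'
  have h1 : k * Real.exp (-(k * τ)) / k < 1 := by
    rw [mul_div_cancel_left₀ _ hk.ne']
    have : 0 < k * τ := mul_pos hk hτ
    exact Real.exp_lt_one_iff.2 (by linarith)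
  have h2 := hcont.eventually_lt (continuousAt_const (y := (1 : ℝ))) h1
  have h3 : ∀ᶠ r in nhdsWithin k (Set.Iio k), k * Real.exp (-(r * τ)) / r < 1 :=
    h2.filter_mono nhdsWithin_le_nhds
  have h4 : ∀ᶠ r in nhdsWithin k (Set.Iio k), r < k := self_mem_nhdsWithin
  have h5 : ∀ᶠ r in nhdsWithin k (Set.Iio k), 0 < r :=
    (lt_mem_nhds hk).filter_mono nhdsWithin_le_nhds
  obtain ⟨r, hr⟩ := (h3.and (h4.and h5)).exists
  exact ⟨r, hr.2.2, hr.2.1, hr.1⟩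

lemma delayedExp_le (τ k r t : ℝ) (hτ : 0 < τ) (hk : 0 < k) (hr : 0 < r)
    (hq : k * Real.exp (-(r * τ)) / r < 1) (ht : 0 < t) :
    delayedExp τ k t ≤ Real.exp (r * (t + τ)) * (1 - k * Real.exp (-(r * τ)) / r)⁻¹ := by
  unfold delayedExp
  rw [if_neg (by linarith)]
  set q := k * Real.exp (-(r * τ)) / r with hqd
  have hq0 : 0 ≤ q := by positivity
  have hterm : ∀ j ∈ Finset.range (⌊t / τ⌋ + 2).toNat,
      k ^ j * (t - ((j : ℝ) - 1) * τ) ^ j / (Nat.factorial j : ℝ)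
        ≤ Real.exp (r * (t + τ)) * q ^ j := by
    intro j hj
    have hj' : (j : ℤ) - 1 ≤ ⌊t / τ⌋ := by
      have := Finset.mem_range.1 hj
      omega
    have hx : ((j : ℝ) - 1) * τ ≤ t := by
      have := Int.le_floor.1 hj'
      push_cast at this
      exact (le_div_iff₀ hτ).1 this
    set x := t - ((j : ℝ) - 1) * τ with hxd
    have hx0 : 0 ≤ x := by linarith
    have h := Real.pow_div_factorial_le_exp (r * x) (by positivity) j
    have e1 : k ^ j * x ^ j / (Nat.factorial j : ℝ)
        = (k / r) ^ j * ((r * x) ^ j / (Nat.factorial j : ℝ)) := by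
      rw [div_pow, mul_pow]; field_simp
    have e2 : Real.exp (r * (t + τ)) * q ^ j = (k / r) ^ j * Real.exp (r * x) := by
      have : q = (k / r) * Real.exp (-(r * τ)) := by rw [hqd]; ring
      rw [this, mul_pow, ← Real.exp_nat_mul, mul_left_comm, ← Real.exp_add]
      congr 2
      rw [hxd]; ring
    rw [e1, e2]
    gcongr
  refine (Finset.sum_le_sum hterm).trans ?_
  rw [← Finset.mul_sum, ← tsum_geometric_of_lt_one hq0 hq]
  gcongr
  exact (summable_geometric_of_lt_one hq0 hq).sum_le_tsum _ (fun i _ => by positivity)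

/-- for `τ > 0`, `k̄ > 0` and arbitrary `γ > 0` there is `C > 0` with
`e_τ^{k̄t} ≤ C (1+t)^{-γ} e^{k̄t}` for all `t > 0`. -/
theorem delayedExp_decay (τ kbar γ : ℝ) (hτ : 0 < τ) (hk : 0 < kbar) (hγ : 0 < γ) :
    ∃ C > (0 : ℝ), ∀ t > (0 : ℝ),
      delayedExp τ kbar t ≤ C * (1 + t) ^ (-γ) * Real.exp (kbar * t) := by
  obtain ⟨r, hr, hrk, hq⟩ := exists_rate τ kbar hτ hk
  set A := (1 - kbar * Real.exp (-(r * τ)) / r)⁻¹ with hA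
  have hA0 : 0 < A := inv_pos.2 (by linarith)
  have hd : 0 < kbar - r := by linarith
  refine ⟨A * Real.exp (r * τ + ((kbar - r) - γ - γ * Real.log ((kbar - r) / γ))),
    by positivity, fun t ht => ?_⟩
  refine (delayedExp_le τ kbar r t hτ hk hr hq ht).trans ?_
  rw [← hA, Real.rpow_def_of_pos (by linarith), mul_comm, mul_assoc, mul_assoc,
    ← Real.exp_add, ← Real.exp_add]
  gcongr
  have hl := Real.log_le_sub_one_of_pos (x := (kbar - r) / γ * (1 + t)) (by positivity)
  rw [Real.log_mul (by positivity) (by positivity)] at hl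
  have h2 := mul_le_mul_of_nonneg_left hl hγ.le
  have h3 : γ * ((kbar - r) / γ * (1 + t) - 1) = (kbar - r) * (1 + t) - γ := by
    field_simp
  rw [h3] at h2
  nlinarith

end
end

section
/- Let J:ℝⁿ→ℝ be nonnegative, integrable with ∫_{ℝⁿ}J=1, even (J(−y)=J(y)), and suppose Ĵ(ξ)=1−𝒦|ξ|^α+o(|ξ|^α) as ξ→0 for some α∈(0,2] and 𝒦>0. Then there exist constants K₁∈(0,𝒦) and ã>0 such that 1−Ĵ(η) ≥ K₁|η|^α for all |η|≤ã, and 1−Ĵ(η) ≥ K₁ã^α for all |η|≥ã. -/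
open MeasureTheory Real Set Filter Asymptotics

noncomputable section

lemma FT_re_eq {n : ℕ} (J : Rn n → ℝ) (hJint : Integrable J) (η : Rn n) :
    Integrable (fun y => Real.cos (inner ℝ y η) * J y) ∧
    (FT J η).re = ∫ y, Real.cos (inner ℝ y η) * J y := by
  have hc : Integrable (fun y : Rn n => Real.cos (inner ℝ y η) * J y) := by
    refine hJint.bdd_mul (c := 1) ?_ ?_
    · exact (by fun_prop : Continuous fun y : Rn n => Real.cos (inner ℝ y η)).aestronglyMeasurable
    · exact Eventually.of_forall fun y => by simpa using Real.abs_cos_le_one _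
  have hi : Integrable (fun y : Rn n =>
      Complex.exp (-Complex.I * ((inner ℝ y η : ℝ) : ℂ)) * (J y : ℂ)) := by
    refine hJint.ofReal.bdd_mul (c := 1) ?_ ?_
    · exact (by fun_prop : Continuous fun y : Rn n =>
        Complex.exp (-Complex.I * ((inner ℝ y η : ℝ) : ℂ))).aestronglyMeasurable
    · exact Eventually.of_forall fun y => by simp [Complex.norm_exp]
  refine ⟨hc, ?_⟩
  have := (integral_re hi).symm
  simp only [RCLike.re_to_complex] at this
  rw [FT, this]
  congr 1
  ext y
  simp [Complex.exp_re]

lemma FT_double {n : ℕ} (J : Rn n → ℝ) (hJ0 : ∀ y, 0 ≤ J y) (hJint : Integrable J)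
    (hJ1 : (∫ y, J y) = 1) (η : Rn n) :
    1 - (FT J ((2:ℝ) • η)).re ≤ 4 * (1 - (FT J η).re) := by
  obtain ⟨i1, e1⟩ := FT_re_eq J hJint η
  obtain ⟨i2, e2⟩ := FT_re_eq J hJint ((2:ℝ) • η)
  rw [e1, e2, ← hJ1, ← integral_sub hJint i1, ← integral_sub hJint i2, ← integral_const_mul]
  refine integral_mono (hJint.sub i2) ((hJint.sub i1).const_mul 4) fun y => ?_
  simp only [inner_smul_right, Real.cos_two_mul]
  nlinarith [mul_nonneg (hJ0 y) (sq_nonneg (1 - Real.cos (inner ℝ y η)))]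

lemma FT_pow {n : ℕ} (J : Rn n → ℝ) (hJ0 : ∀ y, 0 ≤ J y) (hJint : Integrable J)
    (hJ1 : (∫ y, J y) = 1) (η : Rn n) (k : ℕ) :
    1 - (FT J ((2:ℝ) ^ k • η)).re ≤ 4 ^ k * (1 - (FT J η).re) := by
  induction k with
  | zero => simp
  | succ k ih =>
    have h := FT_double J hJ0 hJint hJ1 ((2:ℝ) ^ k • η)
    rw [smul_smul, ← pow_succ'] at h
    rw [pow_succ' (4:ℝ)]
    linarith

lemma FT_tendsto {n : ℕ} (J : Rn n → ℝ) :
    Tendsto (FT J) (cocompact (Rn n)) (nhds 0) := by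
  have h := tendsto_integral_exp_inner_smul_cocompact (fun y : Rn n => (J y : ℂ))
  have hpi : (2 * π)⁻¹ ≠ 0 := by positivity
  have h2 : Tendsto (fun η : Rn n => (2 * π)⁻¹ • η) (cocompact (Rn n)) (cocompact (Rn n)) :=
    (Homeomorph.smulOfNeZero _ hpi).isClosedEmbedding.tendsto_cocompact
  refine (h.comp h2).congr fun η => ?_
  simp only [Function.comp, FT]
  congr 1
  ext y
  rw [Circle.smul_def, Real.fourierChar_apply, smul_eq_mul, inner_smul_right]
  congr 2
  have : (π : ℂ) ≠ 0 := by exact_mod_cast Real.pi_ne_zero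
  push_cast
  field_simp

/-- if `Ĵ(ξ) = 1 - 𝒦|ξ|^α + o(|ξ|^α)` as `ξ → 0`, then there are
`K₁ ∈ (0,𝒦)` and `ã > 0` with `1 - Ĵ(η) ≥ K₁|η|^α` for `|η| ≤ ã` and
`1 - Ĵ(η) ≥ K₁ ã^α` for `|η| ≥ ã`. -/
theorem kernel_fourier_lower_bound {n : ℕ} (J : Rn n → ℝ) (K alpha : ℝ)
    (hJ0 : ∀ y, 0 ≤ J y) (hJint : Integrable J) (hJ1 : (∫ y, J y) = 1)
    (heven : ∀ y, J (-y) = J y)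
    (hK : 0 < K) (hal : 0 < alpha) (hal2 : alpha ≤ 2)
    (hJ2 : (fun ξ : Rn n => (FT J ξ).re - (1 - K * ‖ξ‖ ^ alpha))
        =o[nhds 0] fun ξ : Rn n => ‖ξ‖ ^ alpha) :
    ∃ K₁ atil : ℝ, 0 < K₁ ∧ K₁ < K ∧ 0 < atil ∧
      (∀ η : Rn n, ‖η‖ ≤ atil → K₁ * ‖η‖ ^ alpha ≤ 1 - (FT J η).re) ∧
      (∀ η : Rn n, atil ≤ ‖η‖ → K₁ * atil ^ alpha ≤ 1 - (FT J η).re) := by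
  have hev := hJ2.bound (half_pos hK)
  obtain ⟨δ, hδ, hball⟩ := Metric.eventually_nhds_iff.1 hev
  have hloc : ∀ η : Rn n, ‖η‖ < δ → K / 2 * ‖η‖ ^ alpha ≤ 1 - (FT J η).re := by
    intro η hη
    have h := hball (y := η) (by simpa using hη)
    rw [Real.norm_eq_abs, Real.norm_of_nonneg (by positivity)] at h
    have := (abs_le.1 h).2
    linarith
  have hlim : ∀ᶠ η in cocompact (Rn n), ‖FT J η‖ < 1 / 2 := by
    have := (FT_tendsto J).norm
    rw [norm_zero] at this
    exact this.eventually (gt_mem_nhds (by norm_num))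
  rw [← Metric.cobounded_eq_cocompact, ← comap_norm_atTop, eventually_comap] at hlim
  obtain ⟨R, hR⟩ := eventually_atTop.1 hlim
  obtain ⟨k, hk⟩ := pow_unbounded_of_one_lt (R / (δ / 2)) (one_lt_two : (1:ℝ) < 2)
  have hk' : R < 2 ^ k * (δ / 2) := (div_lt_iff₀ (by positivity)).1 hk
  have hfar : ∀ η : Rn n, δ / 2 ≤ ‖η‖ → 1 / (2 * 4 ^ k) ≤ 1 - (FT J η).re := by
    intro η hη
    have h1 := FT_pow J hJ0 hJint hJ1 η k
    have h2 := hR ‖(2:ℝ) ^ k • η‖ (by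
      rw [norm_smul, norm_pow, Real.norm_two]
      have : (2:ℝ) ^ k * (δ / 2) ≤ 2 ^ k * ‖η‖ := by gcongr
      linarith) _ rfl
    have h3 := (Complex.re_le_norm (FT J ((2:ℝ) ^ k • η)))
    rw [div_le_iff₀ (by positivity)]
    linarith
  have hp : 0 < (δ / 2) ^ alpha := by positivity
  refine ⟨min (K / 2) (1 / (2 * 4 ^ k) / (δ / 2) ^ alpha), δ / 2, by positivity, ?_,
    by positivity, ?_, ?_⟩
  · exact (min_le_left _ _).trans_lt (half_lt_self hK)
  · intro η hη
    refine le_trans ?_ (hloc η (by linarith))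
    gcongr
    exact min_le_left _ _
  · intro η hη
    refine le_trans ?_ (hfar η hη)
    rw [← le_div_iff₀ hp]
    exact min_le_right _ _

end
end

section
/- Assume (H1)-(H3), let J:ℝⁿ→ℝ be nonnegative and integrable with ∫_{ℝⁿ}J=1, let τ≥0, β>0, and let u₀ be continuous on [−τ,0]×ℝⁿ with 0=u₋≤u₀(s,x)≤u₊ for all (s,x)∈[−τ,0]×ℝⁿ. Then the Cauchy problem has a unique global solution u:[−τ,∞)×ℝⁿ→ℝ: u is continuous, u(s,·)=u₀(s,·) for s∈[−τ,0], t↦u(t,x) is continuously differentiable on (0,∞) with the equation satisfied for all t>0, x∈ℝⁿ, and u₋ ≤ u(t,x) ≤ u₊ for all (t,x)∈[0,∞)×ℝⁿ. -/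
open MeasureTheory Real Set Filter Asymptotics

noncomputable section

theorem aux_fixpt {E : Type*} [TopologicalSpace E] (h : E → ℝ) (hc : Continuous h)
    (h1 : ∀ p, 1 ≤ h p) (M : ℝ) (hM : 0 ≤ M) (T : (E → ℝ) → (E → ℝ)) (q : ℝ) (hq0 : 0 ≤ q)
    (hq1 : q < 1)
    (hT : ∀ v, Continuous v → (∀ p, v p ∈ Icc 0 M) →
      Continuous (T v) ∧ ∀ p, T v p ∈ Icc 0 M)
    (hL : ∀ v w, Continuous v → (∀ p, v p ∈ Icc 0 M) → Continuous w → (∀ p, w p ∈ Icc 0 M) →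
      ∀ δ, 0 ≤ δ → (∀ p, |v p - w p| ≤ δ * h p) → ∀ p, |T v p - T w p| ≤ q * δ * h p) :
    ∃ v, Continuous v ∧ (∀ p, v p ∈ Icc 0 M) ∧ T v = v ∧
      ∀ w, Continuous w → (∀ p, w p ∈ Icc 0 M) → T w = w → w = v := by
  have hpos : ∀ p, 0 < h p := fun p => lt_of_lt_of_le one_pos (h1 p)
  let S : Set (BoundedContinuousFunction E ℝ) := {w | ∀ p, h p * w p ∈ Icc 0 M}
  have hS : IsClosed S := by
    have : S = ⋂ p, {w : BoundedContinuousFunction E ℝ | h p * w p ∈ Icc 0 M} := by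
      ext w; simp [S]
    rw [this]
    refine isClosed_iInter fun p => ?_
    refine isClosed_Icc.preimage (f := fun w : BoundedContinuousFunction E ℝ => h p * w p) ?_
    exact continuous_const.mul (continuous_eval_const p)
  have mk : ∀ v : E → ℝ, Continuous v → (∀ p, v p ∈ Icc 0 M) → ∃ w : S, ∀ p, v p = h p * w.1 p := by
    intro v hv hb
    refine ⟨⟨BoundedContinuousFunction.ofNormedAddCommGroup (fun p => v p / h p)
      (hv.div hc fun p => (hpos p).ne') M ?_, ?_⟩, ?_⟩
    · intro p
      rw [Real.norm_eq_abs, abs_div, abs_of_pos (hpos p), abs_of_nonneg (hb p).1]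
      exact (div_le_self (hb p).1 (h1 p)).trans (hb p).2
    · intro p
      have := hpos p
      simp only [BoundedContinuousFunction.coe_ofNormedAddCommGroup]
      rw [mul_div_cancel₀ _ this.ne']
      exact hb p
    · intro p
      have := hpos p
      simp only [BoundedContinuousFunction.coe_ofNormedAddCommGroup]
      rw [mul_div_cancel₀ _ this.ne']
  have hw : ∀ w : S, Continuous (fun p => h p * w.1 p) := fun w => hc.mul w.1.continuous
  have key : ∀ w : S, ∃ w' : S, ∀ p, T (fun p => h p * w.1 p) p = h p * w'.1 p := fun w =>
    mk _ (hT _ (hw w) w.2).1 (hT _ (hw w) w.2).2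
  choose Φ hΦ using key
  have hcon : ContractingWith ⟨q, hq0⟩ Φ := by
    refine ⟨by exact_mod_cast hq1, LipschitzWith.of_dist_le_mul fun w w' => ?_⟩
    rw [Subtype.dist_eq, BoundedContinuousFunction.dist_le (by positivity)]
    intro p
    have := hL _ _ (hw w) w.2 (hw w') w'.2 (dist w w') dist_nonneg (fun p => by
      rw [← mul_sub, abs_mul, abs_of_pos (hpos p), mul_comm]
      exact mul_le_mul_of_nonneg_right (BoundedContinuousFunction.dist_coe_le_dist (f := w.1) (g := w'.1) p)
        (hpos p).le) p
    rw [hΦ, hΦ, ← mul_sub, abs_mul, abs_of_pos (hpos p), mul_comm] at this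
    exact le_of_mul_le_mul_right this (hpos p)
  obtain ⟨w0, _⟩ := mk (fun _ => 0) continuous_const (fun _ => ⟨le_rfl, hM⟩)
  have : Nonempty S := ⟨w0⟩
  have : CompleteSpace S := hS.completeSpace_coe
  have hfix := hcon.fixedPoint_isFixedPt
  refine ⟨fun p => h p * (hcon.fixedPoint).1 p, hw _, (hcon.fixedPoint).2, ?_, ?_⟩
  · funext p
    rw [hΦ, hfix]
  · intro v hv hb hTv
    obtain ⟨w, hwv⟩ := mk v hv hb
    have hv' : v = fun p => h p * w.1 p := funext hwv
    have : Φ w = w := by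
      apply Subtype.ext
      ext p
      have h2 := hΦ w p
      rw [← hv', hTv, hwv] at h2
      exact (mul_left_cancel₀ (hpos p).ne' h2).symm
    have := hcon.fixedPoint_unique this
    rw [hv', this]

def cv {n : ℕ} (K : Rn n → ℝ) (g : ℝ × Rn n → ℝ) (p : ℝ × Rn n) : ℝ :=
  ∫ y, K y * g (p.1, p.2 - y)

theorem cv_int {n : ℕ} {K : Rn n → ℝ} (hK : Integrable K) {g : ℝ × Rn n → ℝ}
    (hg : Continuous g) {M : ℝ} (hb : ∀ p, g p ∈ Icc 0 M) (p : ℝ × Rn n) :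
    Integrable (fun y => K y * g (p.1, p.2 - y)) := by
  refine hK.mul_bdd (c := M) (Continuous.aestronglyMeasurable (by fun_prop)) (ae_of_all _ fun y => ?_)
  rw [Real.norm_eq_abs, abs_of_nonneg (hb _).1]; exact (hb _).2

theorem cv_cont {n : ℕ} {K : Rn n → ℝ} (hK : Integrable K) {g : ℝ × Rn n → ℝ}
    (hg : Continuous g) {M : ℝ} (hb : ∀ p, g p ∈ Icc 0 M) : Continuous (cv K g) := by
  unfold cv
  refine continuous_of_dominated (bound := fun y => ‖K y‖ * M)
    (fun p => (cv_int hK hg hb p).aestronglyMeasurable) (fun p => ae_of_all _ fun y => ?_)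
    (hK.norm.mul_const M) (ae_of_all _ fun y => by fun_prop)
  rw [norm_mul]
  refine mul_le_mul_of_nonneg_left ?_ (norm_nonneg _)
  rw [Real.norm_eq_abs, abs_of_nonneg (hb _).1]; exact (hb _).2

theorem cv_mem {n : ℕ} {K : Rn n → ℝ} (hK : Integrable K) (hK0 : ∀ y, 0 ≤ K y)
    (hK1 : ∫ y, K y = 1) {g : ℝ × Rn n → ℝ}
    (hg : Continuous g) {M : ℝ} (hb : ∀ p, g p ∈ Icc 0 M) (p : ℝ × Rn n) :
    cv K g p ∈ Icc 0 M := by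
  constructor
  · exact integral_nonneg fun y => mul_nonneg (hK0 y) (hb _).1
  · calc cv K g p ≤ ∫ y, K y * M := integral_mono (cv_int hK hg hb p) (hK.mul_const M)
          fun y => mul_le_mul_of_nonneg_left (hb _).2 (hK0 y)
      _ = M := by rw [integral_mul_const, hK1, one_mul]

theorem cv_sub {n : ℕ} {K : Rn n → ℝ} (hK : Integrable K) (hK0 : ∀ y, 0 ≤ K y)
    (hK1 : ∫ y, K y = 1) {g g' : ℝ × Rn n → ℝ}
    (hg : Continuous g) {M : ℝ} (hb : ∀ p, g p ∈ Icc 0 M)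
    (hg' : Continuous g') (hb' : ∀ p, g' p ∈ Icc 0 M) (p : ℝ × Rn n) (c : ℝ)
    (hc : ∀ x, |g (p.1, x) - g' (p.1, x)| ≤ c) :
    |cv K g p - cv K g' p| ≤ c := by
  unfold cv
  rw [← integral_sub (cv_int hK hg hb p) (cv_int hK hg' hb' p)]
  calc _ ≤ ∫ y, K y * c := by
        rw [← Real.norm_eq_abs]
        refine norm_integral_le_of_norm_le (hK.mul_const c) (ae_of_all _ fun y => ?_)
        rw [← mul_sub, norm_mul, Real.norm_eq_abs, Real.norm_eq_abs, abs_of_nonneg (hK0 y)]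
        exact mul_le_mul_of_nonneg_left (hc _) (hK0 y)
    _ = c := by rw [integral_mul_const, hK1, one_mul]

theorem heat_int1 (n : ℕ) {β : ℝ} (hβ : 0 < β) : ∫ y, heatKernel n β y = 1 := by
  unfold heatKernel
  rw [integral_const_mul]
  have h := GaussianFourier.integral_rexp_neg_mul_sq_norm (V := Rn n) (b := 1 / (4 * β)) (by positivity)
  have e : ∀ y : Rn n, -‖y‖ ^ 2 / (4 * β) = -(1 / (4 * β)) * ‖y‖ ^ 2 := fun y => by ring
  simp_rw [e]
  rw [h, finrank_euclideanSpace_fin]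
  have : π / (1 / (4 * β)) = 4 * π * β := by field_simp
  rw [this, ← Real.rpow_add (by positivity)]
  have : (-(n:ℝ) / 2 + n / 2) = 0 := by ring
  rw [this, Real.rpow_zero]

theorem heat_int (n : ℕ) {β : ℝ} (hβ : 0 < β) : Integrable (heatKernel n β) :=
  Integrable.of_integral_ne_zero (by rw [heat_int1 n hβ]; exact one_ne_zero)

theorem heat_nn (n : ℕ) {β : ℝ} (hβ : 0 < β) (y : Rn n) : 0 ≤ heatKernel n β y := by
  unfold heatKernel; positivity


def GG {n : ℕ} (J f : Rn n → ℝ) (F B : ℝ → ℝ) (τ : ℝ) (v : ℝ × Rn n → ℝ) (p : ℝ × Rn n) : ℝ :=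
  cv J v p + F (v p) + cv f (fun p => B (v (p.1 - τ, p.2))) p

def TT {n : ℕ} (J f : Rn n → ℝ) (F B : ℝ → ℝ) (τ k : ℝ) (U0 v : ℝ × Rn n → ℝ)
    (p : ℝ × Rn n) : ℝ :=
  Real.exp (-(k * max p.1 0)) *
    (U0 p + ∫ s in (0:ℝ)..(max p.1 0), Real.exp (k * s) * GG J f F B τ v (s, p.2))

theorem int_exp {c : ℝ} (hc : 0 < c) (a : ℝ) :
    ∫ s in (0:ℝ)..a, Real.exp (c * s) = (Real.exp (c * a) - 1) / c := by
  rw [intervalIntegral.integral_comp_mul_left (fun s => Real.exp s) hc.ne']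
  simp [div_eq_inv_mul]

section
variable {n : ℕ} {J f : Rn n → ℝ} {F B : ℝ → ℝ} {τ k M : ℝ}

theorem GG_cont (hJ : Integrable J) (hf : Integrable f)
    (hFc : ContinuousOn F (Icc 0 M)) (hBc : ContinuousOn B (Icc 0 M))
    (hB : ∀ u ∈ Icc 0 M, B u ∈ Icc 0 (B M))
    {v : ℝ × Rn n → ℝ} (hv : Continuous v) (hb : ∀ p, v p ∈ Icc 0 M) :
    Continuous (GG J f F B τ v) := by
  have h1 := cv_cont hJ hv hb
  have h2 : Continuous (fun p => F (v p)) := hFc.comp_continuous hv hb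
  have h3 : Continuous (fun p : ℝ × Rn n => B (v (p.1 - τ, p.2))) :=
    hBc.comp_continuous (by fun_prop) (fun p => hb _)
  have h4 := cv_cont hf h3 (fun p => hB _ (hb _))
  exact (h1.add h2).add h4

theorem GG_mem (hJ : Integrable J) (hJ0 : ∀ y, 0 ≤ J y) (hJ1 : ∫ y, J y = 1)
    (hf : Integrable f) (hf0 : ∀ y, 0 ≤ f y) (hf1 : ∫ y, f y = 1)
    (hBc : ContinuousOn B (Icc 0 M))
    (hF : ∀ u ∈ Icc 0 M, F u ∈ Icc 0 (F M))
    (hB : ∀ u ∈ Icc 0 M, B u ∈ Icc 0 (B M)) (hk : F M + B M = (k - 1) * M)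
    {v : ℝ × Rn n → ℝ} (hv : Continuous v) (hb : ∀ p, v p ∈ Icc 0 M) (p : ℝ × Rn n) :
    GG J f F B τ v p ∈ Icc 0 (k * M) := by
  have h1 := cv_mem hJ hJ0 hJ1 hv hb p
  have h2 := hF _ (hb p)
  have h3 : Continuous (fun p : ℝ × Rn n => B (v (p.1 - τ, p.2))) :=
    hBc.comp_continuous (by fun_prop) (fun p => hb _)
  have h4 := cv_mem hf hf0 hf1 h3 (fun p => hB _ (hb _)) p
  unfold GG
  constructor
  · linarith [h1.1, h2.1, h4.1]
  · linarith [h1.2, h2.2, h4.2]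

theorem GG_lip (hτ : 0 ≤ τ) (hJ : Integrable J) (hJ0 : ∀ y, 0 ≤ J y) (hJ1 : ∫ y, J y = 1)
    (hf : Integrable f) (hf0 : ∀ y, 0 ≤ f y) (hf1 : ∫ y, f y = 1)
    (hBc : ContinuousOn B (Icc 0 M))
    (hB : ∀ u ∈ Icc 0 M, B u ∈ Icc 0 (B M)) {LF LB : ℝ} (hLF : 0 ≤ LF) (hLB : 0 ≤ LB)
    (hFl : ∀ u ∈ Icc 0 M, ∀ w ∈ Icc 0 M, |F u - F w| ≤ LF * |u - w|)
    (hBl : ∀ u ∈ Icc 0 M, ∀ w ∈ Icc 0 M, |B u - B w| ≤ LB * |u - w|)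
    {v w : ℝ × Rn n → ℝ} (hv : Continuous v) (hb : ∀ p, v p ∈ Icc 0 M)
    (hw : Continuous w) (hb' : ∀ p, w p ∈ Icc 0 M) {l δ : ℝ} (hl : 0 ≤ l) (hδ : 0 ≤ δ)
    (hvw : ∀ p, |v p - w p| ≤ δ * Real.exp (l * max p.1 0)) (s : ℝ) (hs : 0 ≤ s) (x : Rn n) :
    |GG J f F B τ v (s, x) - GG J f F B τ w (s, x)| ≤ (1 + LF + LB) * (δ * Real.exp (l * s)) := by
  have hvs : ∀ x, |v (s, x) - w (s, x)| ≤ δ * Real.exp (l * s) := fun x => by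
    have := hvw (s, x)
    rwa [max_eq_left hs] at this
  have h1 := cv_sub hJ hJ0 hJ1 hv hb hw hb' (s, x) _ hvs
  have h2 := (hFl _ (hb (s, x)) _ (hb' (s, x))).trans (mul_le_mul_of_nonneg_left (hvs x) hLF)
  have h3 : ∀ v : ℝ × Rn n → ℝ, Continuous v → (∀ p, v p ∈ Icc 0 M) →
      Continuous (fun p : ℝ × Rn n => B (v (p.1 - τ, p.2))) := fun v hv hb =>
    hBc.comp_continuous (by fun_prop) (fun p => hb _)
  have h4 := cv_sub hf hf0 hf1 (h3 v hv hb) (fun p => hB _ (hb _)) (h3 w hw hb')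
    (fun p => hB _ (hb' _)) (s, x) (LB * (δ * Real.exp (l * s))) (fun x => by
      refine (hBl _ (hb _) _ (hb' _)).trans (mul_le_mul_of_nonneg_left ((hvw _).trans ?_) hLB)
      refine mul_le_mul_of_nonneg_left (Real.exp_le_exp.2 (mul_le_mul_of_nonneg_left ?_ hl)) hδ
      exact max_le (by simpa using hτ) hs)
  unfold GG
  rw [abs_le] at *
  constructor
  · linarith [h1.1, h2.1, h4.1]
  · linarith [h1.2, h2.2, h4.2]

theorem main_fix (hτ : 0 ≤ τ) (hJ : Integrable J) (hJ0 : ∀ y, 0 ≤ J y) (hJ1 : ∫ y, J y = 1)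
    (hf : Integrable f) (hf0 : ∀ y, 0 ≤ f y) (hf1 : ∫ y, f y = 1)
    (hFc : ContinuousOn F (Icc 0 M)) (hBc : ContinuousOn B (Icc 0 M))
    (hF : ∀ u ∈ Icc 0 M, F u ∈ Icc 0 (F M))
    (hB : ∀ u ∈ Icc 0 M, B u ∈ Icc 0 (B M)) (hk : F M + B M = (k - 1) * M)
    (hk0 : 0 < k) (hM : 0 ≤ M)
    {LF LB : ℝ} (hLF : 0 ≤ LF) (hLB : 0 ≤ LB)
    (hFl : ∀ u ∈ Icc 0 M, ∀ w ∈ Icc 0 M, |F u - F w| ≤ LF * |u - w|)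
    (hBl : ∀ u ∈ Icc 0 M, ∀ w ∈ Icc 0 M, |B u - B w| ≤ LB * |u - w|)
    {U0 : ℝ × Rn n → ℝ} (hU0 : Continuous U0) (hU0b : ∀ p, U0 p ∈ Icc 0 M) :
    ∃ v, Continuous v ∧ (∀ p, v p ∈ Icc 0 M) ∧ TT J f F B τ k U0 v = v ∧
      ∀ w, Continuous w → (∀ p, w p ∈ Icc 0 M) → TT J f F B τ k U0 w = w → w = v := by
  set C := 1 + LF + LB with hC
  have hC0 : 0 < C := by positivity
  have hGc : ∀ v, Continuous v → (∀ p, v p ∈ Icc 0 M) → ∀ x : Rn n,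
      Continuous (fun s => Real.exp (k * s) * GG J f F B τ v (s, x)) := fun v hv hb x => by
    have := GG_cont (τ := τ) hJ hf hFc hBc hB hv hb
    fun_prop
  refine aux_fixpt (fun p : ℝ × Rn n => Real.exp (C * max p.1 0)) (by fun_prop)
    (fun p => Real.one_le_exp (by positivity)) M hM (TT J f F B τ k U0) (C / (k + C))
    (by positivity) ((div_lt_one (by positivity)).2 (by linarith)) ?_ ?_
  · intro v hv hb
    have hG := GG_cont (τ := τ) hJ hf hFc hBc hB hv hb
    have hGm := GG_mem (τ := τ) hJ hJ0 hJ1 hf hf0 hf1 hBc hF hB hk hv hb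
    constructor
    · unfold TT
      refine Continuous.mul (by fun_prop) (hU0.add ?_)
      refine intervalIntegral.continuous_parametric_intervalIntegral_of_continuous
        (f := fun (p : ℝ × Rn n) s => Real.exp (k * s) * GG J f F B τ v (s, p.2)) ?_ (by fun_prop)
      simp only [Function.uncurry_def]
      fun_prop
    · intro p
      have ha : 0 ≤ max p.1 0 := le_max_right _ _
      unfold TT
      set a := max p.1 0
      have hI0 : 0 ≤ ∫ s in (0:ℝ)..a, Real.exp (k * s) * GG J f F B τ v (s, p.2) :=
        intervalIntegral.integral_nonneg ha fun s _ =>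
          mul_nonneg (Real.exp_pos _).le (hGm _).1
      have hI1 : ∫ s in (0:ℝ)..a, Real.exp (k * s) * GG J f F B τ v (s, p.2)
          ≤ ∫ s in (0:ℝ)..a, Real.exp (k * s) * (k * M) :=
        intervalIntegral.integral_mono_on ha ((hGc v hv hb p.2).intervalIntegrable _ _)
          (Continuous.intervalIntegrable (by fun_prop) _ _)
          fun s _ => mul_le_mul_of_nonneg_left (hGm _).2 (Real.exp_pos _).le
      rw [intervalIntegral.integral_mul_const, int_exp hk0] at hI1
      have e : (Real.exp (k * a) - 1) / k * (k * M) = (Real.exp (k * a) - 1) * M := by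
        field_simp
      rw [e] at hI1
      refine ⟨mul_nonneg (Real.exp_pos _).le (add_nonneg (hU0b p).1 hI0), ?_⟩
      rw [Real.exp_neg, inv_mul_le_iff₀ (Real.exp_pos _)]
      linarith [(hU0b p).2]
  · intro v w hv hb hw hb' δ hδ hvw p
    have ha : 0 ≤ max p.1 0 := le_max_right _ _
    unfold TT
    set a := max p.1 0
    have hi := fun v hv hb => (hGc v hv hb p.2).intervalIntegrable (μ := volume) 0 a
    rw [← mul_sub, add_sub_add_left_eq_sub, ← intervalIntegral.integral_sub (hi v hv hb) (hi w hw hb'),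
      abs_mul, Real.abs_exp, Real.exp_neg, inv_mul_le_iff₀ (Real.exp_pos _)]
    have h1 : |∫ s in (0:ℝ)..a, (Real.exp (k * s) * GG J f F B τ v (s, p.2) -
        Real.exp (k * s) * GG J f F B τ w (s, p.2))| ≤
        ∫ s in (0:ℝ)..a, Real.exp ((k + C) * s) * (C * δ) := by
      rw [← Real.norm_eq_abs]
      refine intervalIntegral.norm_integral_le_of_norm_le ha (ae_of_all _ fun s hs => ?_)
        (Continuous.intervalIntegrable (by fun_prop) _ _)
      have := GG_lip hτ hJ hJ0 hJ1 hf hf0 hf1 hBc hB hLF hLB hFl hBl hv hb hw hb' hC0.le hδ hvw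
        s hs.1.le p.2
      rw [← mul_sub, Real.norm_eq_abs, abs_mul, Real.abs_exp, add_mul, Real.exp_add]
      calc _ ≤ Real.exp (k * s) * (C * (δ * Real.exp (C * s))) :=
            mul_le_mul_of_nonneg_left this (Real.exp_pos _).le
        _ = _ := by ring
    refine h1.trans ?_
    rw [intervalIntegral.integral_mul_const, int_exp (by positivity : 0 < k + C)]
    have e : Real.exp (k * a) * (C / (k + C) * δ * Real.exp (C * a)) =
      Real.exp ((k + C) * a) / (k + C) * (C * δ) := by
      rw [add_mul k C a, Real.exp_add]; ring
    rw [e]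
    gcongr
    linarith

theorem TT_fix_of (hJ : Integrable J) (hf : Integrable f)
    (hFc : ContinuousOn F (Icc 0 M)) (hBc : ContinuousOn B (Icc 0 M))
    (hB : ∀ u ∈ Icc 0 M, B u ∈ Icc 0 (B M))
    {U0 v : ℝ × Rn n → ℝ} (hv : Continuous v) (hb : ∀ p, v p ∈ Icc 0 M)
    (hU : ∀ t ≤ 0, ∀ x, U0 (t, x) = v (t, x)) (hU' : ∀ t > 0, ∀ x, U0 (t, x) = v (0, x))
    (hd : ∀ t > 0, ∀ x, HasDerivAt (fun t => v (t, x)) (GG J f F B τ v (t, x) - k * v (t, x)) t) :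
    TT J f F B τ k U0 v = v := by
  funext ⟨t, x⟩
  unfold TT
  rcases le_or_gt t 0 with ht | ht
  · simp [max_eq_right ht, hU t ht]
  · simp only [max_eq_left ht.le, hU' t ht]
    have hG := GG_cont (τ := τ) hJ hf hFc hBc hB hv hb
    have := intervalIntegral.integral_eq_sub_of_hasDerivAt_of_le (a := 0) (b := t)
      (f := fun s => Real.exp (k * s) * v (s, x))
      (f' := fun s => Real.exp (k * s) * GG J f F B τ v (s, x)) ht.le
      (Continuous.continuousOn (by fun_prop))
      (fun s hs => by
        have h1 : HasDerivAt (fun s => Real.exp (k * s)) (Real.exp (k * s) * k) s := by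
          simpa using ((hasDerivAt_id s).const_mul k).exp
        refine (h1.mul (hd s hs.1 x)).congr_deriv ?_
        ring)
      (Continuous.intervalIntegrable (by fun_prop) _ _)
    rw [this, Real.exp_neg]
    simp

theorem TT_deriv (hJ : Integrable J) (hf : Integrable f)
    (hFc : ContinuousOn F (Icc 0 M)) (hBc : ContinuousOn B (Icc 0 M))
    (hB : ∀ u ∈ Icc 0 M, B u ∈ Icc 0 (B M))
    {U0 v : ℝ × Rn n → ℝ} (hv : Continuous v) (hb : ∀ p, v p ∈ Icc 0 M)
    (hU : ∀ t > 0, ∀ x, U0 (t, x) = U0 (0, x))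
    (hT : TT J f F B τ k U0 v = v) (t : ℝ) (ht : 0 < t) (x : Rn n) :
    HasDerivAt (fun t => v (t, x)) (GG J f F B τ v (t, x) - k * v (t, x)) t := by
  have hG := GG_cont (τ := τ) hJ hf hFc hBc hB hv hb
  have hc : Continuous (fun s => Real.exp (k * s) * GG J f F B τ v (s, x)) := by fun_prop
  have e : ∀ t > 0, v (t, x) = Real.exp (-(k * t)) *
      (U0 (0, x) + ∫ s in (0:ℝ)..t, Real.exp (k * s) * GG J f F B τ v (s, x)) := by
    intro t ht
    conv_lhs => rw [← hT]
    unfold TT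
    simp only [max_eq_left ht.le, hU t ht]
  have h1 : HasDerivAt (fun s => Real.exp (-(k * s))) (Real.exp (-(k * t)) * (-k)) t := by
    simpa using ((hasDerivAt_id t).const_mul k).neg.exp
  have h2 := (hc.integral_hasStrictDerivAt 0 t).hasDerivAt.const_add (U0 (0, x))
  have h3 := h1.mul h2
  refine (h3.congr_of_eventuallyEq ?_).congr_deriv ?_
  · filter_upwards [lt_mem_nhds ht] with s hs using e s hs
  · rw [e t ht]
    have : Real.exp (-(k * t)) * Real.exp (k * t) = 1 := by rw [← Real.exp_add]; simp
    linear_combination (GG J f F B τ v (t, x)) * this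

end

/-- global existence and uniqueness for the Cauchy problem of the
nonlocal dispersion equation with monostable nonlinearity. -/
theorem cauchy_existence_uniqueness {n : ℕ} [NeZero n]
    (d b d' b' d'' b'' : ℝ → ℝ) (uplus : ℝ)
    -- (H1)
    (huplus : 0 < uplus) (hd0 : d 0 = 0) (hb0 : b 0 = 0) (hdbu : d uplus = b uplus)
    (hd'def : ∀ u ∈ Set.Icc 0 uplus, HasDerivAt d (d' u) u)
    (hb'def : ∀ u ∈ Set.Icc 0 uplus, HasDerivAt b (b' u) u)
    (hd''def : ∀ u ∈ Set.Icc 0 uplus, HasDerivAt d' (d'' u) u)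
    (hb''def : ∀ u ∈ Set.Icc 0 uplus, HasDerivAt b' (b'' u) u)
    (hd''cont : ContinuousOn d'' (Set.Icc 0 uplus))
    (hb''cont : ContinuousOn b'' (Set.Icc 0 uplus))
    -- (H2)
    (h2a : d' 0 < b' 0) (h2b : 0 ≤ d' 0) (h2c : 0 ≤ b' uplus) (h2d : b' uplus < d' uplus)
    -- (H3)
    (h3 : ∀ u ∈ Set.Icc 0 uplus, 0 ≤ d' u ∧ 0 ≤ b' u ∧ 0 ≤ d'' u ∧ b'' u ≤ 0)
    (J : Rn n → ℝ) (hJ0 : ∀ y, 0 ≤ J y) (hJint : Integrable J)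
    (hJ1 : (∫ y : Rn n, J y) = 1)
    (τ β : ℝ) (hτ : 0 ≤ τ) (hβ : 0 < β)
    (u₀ : ℝ → Rn n → ℝ)
    (hu₀cont : ContinuousOn (fun p : ℝ × Rn n => u₀ p.1 p.2) (Set.Icc (-τ) 0 ×ˢ Set.univ))
    (hu₀bd : ∀ s ∈ Set.Icc (-τ) 0, ∀ x : Rn n, 0 ≤ u₀ s x ∧ u₀ s x ≤ uplus) :
    ∃ u ut : ℝ → Rn n → ℝ,
      ContinuousOn (fun p : ℝ × Rn n => u p.1 p.2) (Set.Ici (-τ) ×ˢ Set.univ) ∧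
      (∀ s ∈ Set.Icc (-τ) 0, ∀ x : Rn n, u s x = u₀ s x) ∧
      (∀ x : Rn n, ContinuousOn (fun t => ut t x) (Set.Ioi 0)) ∧
      (∀ t > (0 : ℝ), ∀ x : Rn n, HasDerivAt (fun t => u t x) (ut t x) t) ∧
      (∀ t > (0 : ℝ), ∀ x : Rn n,
        ut t x - (∫ y : Rn n, J (x - y) * u t y) + u t x + d (u t x)
          = ∫ y : Rn n, heatKernel n β y * b (u (t - τ) (x - y))) ∧
      (∀ t ≥ (0 : ℝ), ∀ x : Rn n, 0 ≤ u t x ∧ u t x ≤ uplus) ∧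
      (∀ u' ut' : ℝ → Rn n → ℝ,
        ContinuousOn (fun p : ℝ × Rn n => u' p.1 p.2) (Set.Ici (-τ) ×ˢ Set.univ) →
        (∀ s ∈ Set.Icc (-τ) 0, ∀ x : Rn n, u' s x = u₀ s x) →
        (∀ t > (0 : ℝ), ∀ x : Rn n, HasDerivAt (fun t => u' t x) (ut' t x) t) →
        (∀ t > (0 : ℝ), ∀ x : Rn n,
          ut' t x - (∫ y : Rn n, J (x - y) * u' t y) + u' t x + d (u' t x)
            = ∫ y : Rn n, heatKernel n β y * b (u' (t - τ) (x - y))) →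
        (∀ t ≥ (0 : ℝ), ∀ x : Rn n, 0 ≤ u' t x ∧ u' t x ≤ uplus) →
        ∀ t ≥ -τ, ∀ x : Rn n, u' t x = u t x) := by
  classical
  have hlip : ∀ g g' g'' : ℝ → ℝ, (∀ u ∈ Icc 0 uplus, HasDerivAt g (g' u) u) →
      (∀ u ∈ Icc 0 uplus, HasDerivAt g' (g'' u) u) →
      ∃ L, 0 ≤ L ∧ ∀ u ∈ Icc 0 uplus, ∀ w ∈ Icc 0 uplus, |g u - g w| ≤ L * |u - w| := by
    intro g g' g'' h1 h2
    have hc : ContinuousOn g' (Icc 0 uplus) := fun u hu =>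
      (h2 u hu).continuousAt.continuousWithinAt
    obtain ⟨L, hL⟩ := isCompact_Icc.exists_bound_of_continuousOn hc
    refine ⟨L, (norm_nonneg _).trans (hL 0 ⟨le_rfl, huplus.le⟩), fun u hu w hw => ?_⟩
    exact Convex.norm_image_sub_le_of_norm_hasDerivWithin_le
      (fun x hx => (h1 x hx).hasDerivWithinAt) hL (convex_Icc _ _) hw hu
  have hcon : ∀ g g' : ℝ → ℝ, (∀ u ∈ Icc 0 uplus, HasDerivAt g (g' u) u) →
      ContinuousOn g (Icc 0 uplus) := fun g g' h u hu => (h u hu).continuousAt.continuousWithinAt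
  obtain ⟨L, hL0, hL⟩ := hlip d d' d'' hd'def hd''def
  obtain ⟨LB, hLB0, hLB⟩ := hlip b b' b'' hb'def hb''def
  have hdc := hcon d d' hd'def
  have hbc := hcon b b' hb'def
  have h0m : (0:ℝ) ∈ Icc 0 uplus := ⟨le_rfl, huplus.le⟩
  have hMm : uplus ∈ Icc 0 uplus := ⟨huplus.le, le_rfl⟩
  have hbmono : MonotoneOn b (Icc 0 uplus) := by
    refine monotoneOn_of_deriv_nonneg (convex_Icc _ _) hbc (fun u hu =>
      (hb'def u (interior_subset hu)).differentiableAt.differentiableWithinAt) (fun u hu => ?_)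
    rw [(hb'def u (interior_subset hu)).deriv]
    exact (h3 u (interior_subset hu)).2.1
  have hB : ∀ u ∈ Icc 0 uplus, b u ∈ Icc 0 (b uplus) := fun u hu =>
    ⟨by rw [← hb0]; exact hbmono h0m hu hu.1, hbmono hu hMm hu.2⟩
  set F : ℝ → ℝ := fun u => L * u - d u with hFdef
  set k : ℝ := 1 + L with hkdef
  have hFc : ContinuousOn F (Icc 0 uplus) := by fun_prop
  have hF : ∀ u ∈ Icc 0 uplus, F u ∈ Icc 0 (F uplus) := by
    intro u hu
    have h1 := (abs_le.1 (hL u hu 0 h0m)).2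
    have h2 := (abs_le.1 (hL uplus hMm u hu)).2
    rw [sub_zero, abs_of_nonneg hu.1, hd0] at h1
    rw [abs_of_nonneg (sub_nonneg.2 hu.2)] at h2
    simp only [hFdef]
    constructor <;> linarith
  have hFl : ∀ u ∈ Icc 0 uplus, ∀ w ∈ Icc 0 uplus, |F u - F w| ≤ (2 * L) * |u - w| := by
    intro u hu w hw
    have h1 := hL u hu w hw
    have e : F u - F w = L * (u - w) - (d u - d w) := by simp only [hFdef]; ring
    rw [e]
    refine (abs_sub _ _).trans ?_
    rw [abs_mul, abs_of_nonneg hL0]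
    linarith
  have hkM : F uplus + b uplus = (k - 1) * uplus := by
    simp only [hFdef, hkdef, ← hdbu]; ring
  have hk0 : 0 < k := by positivity
  have hfi := heat_int n hβ
  have hf0 := heat_nn n hβ
  have hf1 := heat_int1 n hβ
  set U0 : ℝ × Rn n → ℝ := fun p => u₀ (max (-τ) (min p.1 0)) p.2 with hU0def
  have hproj : ∀ t : ℝ, max (-τ) (min t 0) ∈ Icc (-τ) 0 := fun t =>
    ⟨le_max_left _ _, max_le (by linarith) (min_le_right _ _)⟩
  have hU0c : Continuous U0 :=
    hu₀cont.comp_continuous (f := fun p : ℝ × Rn n => (max (-τ) (min p.1 0), p.2)) (by fun_prop)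
      (fun p => ⟨hproj p.1, mem_univ _⟩)
  have hU0b : ∀ p, U0 p ∈ Icc 0 uplus := fun p => hu₀bd _ (hproj _) _
  have hU0t : ∀ t > 0, ∀ x, U0 (t, x) = U0 (0, x) := by
    intro t ht x
    simp only [hU0def, min_eq_right ht.le, min_self]
  have hU0s : ∀ s ∈ Icc (-τ) 0, ∀ x, U0 (s, x) = u₀ s x := by
    intro s hs x
    simp only [hU0def, min_eq_left hs.2, max_eq_right hs.1]
  have hcvJ : ∀ (v : ℝ × Rn n → ℝ) t x, (∫ y : Rn n, J (x - y) * v (t, y)) = cv J v (t, x) := by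
    intro v t x
    unfold cv
    rw [← integral_sub_left_eq_self _ volume x]
    simp
  obtain ⟨v, hv, hvb, hTv, huniq⟩ := main_fix (τ := τ) (k := k) hτ hJint hJ0 hJ1 hfi hf0 hf1 hFc hbc
    hF hB hkM hk0 huplus.le (by positivity) hLB0 hFl hLB hU0c hU0b
  have hG := GG_cont (τ := τ) hJint hfi hFc hbc hB hv hvb
  refine ⟨fun t x => v (t, x),
    fun t x => GG J (heatKernel n β) F b τ v (t, x) - k * v (t, x), ?_, ?_, ?_, ?_, ?_, ?_, ?_⟩
  · exact hv.continuousOn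
  · intro s hs x
    rw [← hU0s s hs x, ← hTv]
    simp [TT, max_eq_right hs.2]
  · intro x
    exact Continuous.continuousOn (by fun_prop)
  · intro t ht x
    exact TT_deriv hJint hfi hFc hbc hB hv hvb hU0t hTv t ht x
  · intro t ht x
    simp only [hcvJ, GG, cv, hFdef, hkdef]
    ring
  · intro t _ x
    exact hvb _
  · intro u' ut' hu'c hu'0 hu'd hu'e hu'b
    set w : ℝ × Rn n → ℝ := fun p => u' (max p.1 (-τ)) p.2 with hwdef
    have hwu : ∀ t ≥ -τ, ∀ x, w (t, x) = u' t x := by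
      intro t ht x
      simp only [hwdef, max_eq_left ht]
    have hwc : Continuous w :=
      hu'c.comp_continuous (f := fun p : ℝ × Rn n => (max p.1 (-τ), p.2)) (by fun_prop)
        (fun p => ⟨mem_Ici.2 (le_max_right _ _), mem_univ _⟩)
    have hwb : ∀ p, w p ∈ Icc 0 uplus := by
      intro p
      rcases le_total 0 (max p.1 (-τ)) with h | h
      · exact hu'b _ h _
      · have hm : max p.1 (-τ) ∈ Icc (-τ) 0 := ⟨le_max_right _ _, h⟩
        simp only [hwdef]
        rw [hu'0 _ hm]
        exact hu₀bd _ hm _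
    have hw : w = v := by
      refine huniq w hwc hwb (TT_fix_of hJint hfi hFc hbc hB hwc hwb ?_ ?_ ?_)
      · intro t ht x
        simp only [hwdef, hU0def, min_eq_left ht]
        rw [max_comm, hu'0 _ ⟨le_max_right _ _, max_le ht (by linarith)⟩]
      · intro t ht x
        rw [hU0t t ht, hU0s 0 ⟨by linarith, le_rfl⟩, hwu 0 (by linarith), hu'0 0 ⟨by linarith, le_rfl⟩]
      · intro t ht x
        have h1 := hu'd t ht x
        have h2 := hu'e t ht x
        have e1 : ∀ y, u' t y = w (t, y) := fun y => (hwu t (by linarith) y).symm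
        have e2 : ∀ y, u' (t - τ) y = w (t - τ, y) := fun y => (hwu (t - τ) (by linarith) y).symm
        simp only [e1, e2, hcvJ] at h2
        refine (h1.congr_of_eventuallyEq ?_).congr_deriv ?_
        · filter_upwards [lt_mem_nhds ht] with s hs using hwu s (by linarith) x
        · simp only [GG, hFdef, hkdef]
          have e3 : cv (heatKernel n β) (fun p => b (w (p.1 - τ, p.2))) (t, x) =
            ∫ y : Rn n, heatKernel n β y * b (w (t - τ, x - y)) := rfl
          rw [e3]
          linarith
    intro t ht x
    rw [← hwu t ht x, hw]

end
end

section
/- Assume (H1)-(H3), let J:ℝⁿ→ℝ be nonnegative and integrable with ∫_{ℝⁿ}J=1, let τ≥0, β>0, T>0, and let u₀ be continuous on [−τ,0]×ℝⁿ with u₋≤u₀≤u₊. Set η₁=max_{u∈[u₋,u₊]}|d'(u)|, η₂=max_{u∈[u₋,u₊]}|b'(u)|, η₀=1+η₁+η₂. Let 𝔅 be the set of continuous functions u:[−τ,T]×ℝⁿ→[u₋,u₊] with u=u₀ on [−τ,0]×ℝⁿ, equipped with ‖u‖_𝔅 = sup_{t∈[0,T]} e^{−η₀t}‖u(t,·)‖_{L∞(ℝⁿ)}.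 Define 𝒫(u)(t,x) = e^{−η₀t}u₀(0,x) + ∫₀ᵗ e^{−η₀(t−s)}[∫_{ℝⁿ}J(x−y)u(s,y)dy + (η₀−1)u(s,x) − d(u(s,x)) + ∫_{ℝⁿ}f_β(y)b(u(s−τ,x−y))dy] ds for 0≤t≤T, and 𝒫(u)(s,x)=u₀(s,x) for s∈[−τ,0]. Then 𝒫 maps 𝔅 into 𝔅, and for all u₁,u₂∈𝔅: ‖𝒫(u₁)−𝒫(u₂)‖_𝔅 ≤ ((2η₀−1)/(2η₀))‖u₁−u₂‖_𝔅, so 𝒫 is a contraction on 𝔅. -/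
open MeasureTheory Real Set Filter Asymptotics

noncomputable section

/-- The integral operator `𝒫`. -/
noncomputable def Pop {n : ℕ} (J : Rn n → ℝ) (β τ η₀ : ℝ) (d b : ℝ → ℝ)
    (u₀ u : ℝ → Rn n → ℝ) (t : ℝ) (x : Rn n) : ℝ :=
  if t < 0 then u₀ t x
  else Real.exp (-η₀ * t) * u₀ 0 x
    + ∫ s in (0 : ℝ)..t, Real.exp (-η₀ * (t - s)) *
        ((∫ y : Rn n, J (x - y) * u s y) + (η₀ - 1) * u s x - d (u s x)
          + ∫ y : Rn n, heatKernel n β y * b (u (s - τ) (x - y)))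

/-- Membership in the solution space `𝔅`. -/
def Bmem {n : ℕ} (τ T uplus : ℝ) (u₀ u : ℝ → Rn n → ℝ) : Prop :=
  ContinuousOn (fun p : ℝ × Rn n => u p.1 p.2) (Set.Icc (-τ) T ×ˢ Set.univ) ∧
  (∀ t ∈ Set.Icc (-τ) T, ∀ x : Rn n, 0 ≤ u t x ∧ u t x ≤ uplus) ∧
  (∀ s ∈ Set.Icc (-τ) 0, ∀ x : Rn n, u s x = u₀ s x)

/-- The norm `‖u‖_𝔅 = sup_{t∈[0,T]} e^{-η₀ t} ‖u(t,·)‖_{L^∞}`. -/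
noncomputable def Bnorm {n : ℕ} (T η₀ : ℝ) (f : ℝ → Rn n → ℝ) : ℝ :=
  ⨆ t : Set.Icc (0 : ℝ) T, Real.exp (-η₀ * (t : ℝ)) * ⨆ x : Rn n, |f (t : ℝ) x|

theorem hk_int {n : ℕ} {β : ℝ} (hβ : 0 < β) : (∫ y : Rn n, heatKernel n β y) = 1 := by
  unfold heatKernel
  rw [integral_const_mul]
  have h := GaussianFourier.integral_rexp_neg_mul_sq_norm (V := Rn n) (b := 1 / (4 * β)) (by positivity)
  have e : (fun v : Rn n => rexp (-‖v‖ ^ 2 / (4 * β))) = fun v => rexp (-(1 / (4 * β)) * ‖v‖ ^ 2) := by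
    funext v; congr 1; ring
  rw [e, h]
  have : π / (1 / (4 * β)) = 4 * π * β := by field_simp
  rw [this, finrank_euclideanSpace_fin, ← Real.rpow_add (by positivity)]
  have : -(n : ℝ) / 2 + n / 2 = 0 := by ring
  rw [this, Real.rpow_zero]

theorem hk_integrable {n : ℕ} {β : ℝ} (hβ : 0 < β) : Integrable (heatKernel n β) := by
  by_contra h
  have := integral_undef h
  rw [hk_int hβ] at this
  norm_num at this

theorem hk_nonneg {n : ℕ} {β : ℝ} (hβ : 0 < β) (y : Rn n) : 0 ≤ heatKernel n β y := by
  unfold heatKernel; positivity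

theorem avg_integrable {n : ℕ} {K w : Rn n → ℝ} {C : ℝ} (hK : Integrable K) (hw : Continuous w)
    (hb : ∀ y, |w y| ≤ C) : Integrable (fun y => K y * w y) :=
  hK.mul_bdd (c := C) hw.aestronglyMeasurable (Eventually.of_forall hb)

theorem avg_bounds {n : ℕ} {K w : Rn n → ℝ} {a c : ℝ} (hK : Integrable K) (hK0 : ∀ y, 0 ≤ K y)
    (hK1 : ∫ y, K y = 1) (hw : Continuous w)
    (ha : ∀ y, a ≤ w y) (hc : ∀ y, w y ≤ c) :
    a ≤ (∫ y, K y * w y) ∧ (∫ y, K y * w y) ≤ c := by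
  have hi : Integrable (fun y => K y * w y) :=
    avg_integrable (C := max |a| |c|) hK hw (fun y => abs_le_max_abs_abs (ha y) (hc y))
  have e : ∀ r : ℝ, (∫ y, K y * r) = r := fun r => by rw [integral_mul_const, hK1, one_mul]
  constructor
  · calc a = ∫ y, K y * a := (e a).symm
      _ ≤ _ := integral_mono (hK.mul_const a) hi
        (fun y => mul_le_mul_of_nonneg_left (ha y) (hK0 y))
  · refine le_trans (integral_mono hi (hK.mul_const c)
        (fun y => mul_le_mul_of_nonneg_left (hc y) (hK0 y))) (le_of_eq (e c))

theorem avg_diff {n : ℕ} {K w₁ w₂ : Rn n → ℝ} {C E : ℝ} (hK : Integrable K) (hK0 : ∀ y, 0 ≤ K y)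
    (hK1 : ∫ y, K y = 1) (hw₁ : Continuous w₁) (hw₂ : Continuous w₂)
    (h1 : ∀ y, |w₁ y| ≤ C) (h2 : ∀ y, |w₂ y| ≤ C) (h : ∀ y, |w₁ y - w₂ y| ≤ E) :
    |(∫ y, K y * w₁ y) - ∫ y, K y * w₂ y| ≤ E := by
  rw [← integral_sub (avg_integrable hK hw₁ h1) (avg_integrable hK hw₂ h2)]
  have := avg_bounds (a := -E) (c := E) hK hK0 hK1 (hw₁.sub hw₂)
    (fun y => (abs_le.1 (h y)).1) (fun y => (abs_le.1 (h y)).2)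
  rw [abs_le]
  simpa only [Pi.sub_apply, mul_sub] using this

theorem conv_cont {n : ℕ} {K : Rn n → ℝ} {w : ℝ × Rn n → ℝ} {C : ℝ} (hK : Integrable K)
    (hw : Continuous w) (hb : ∀ p, |w p| ≤ C) :
    Continuous (fun p : ℝ × Rn n => ∫ y, K y * w (p.1, p.2 - y)) := by
  refine continuous_of_dominated (bound := fun y => |K y| * C) ?_ ?_ ?_ ?_
  · intro p
    exact hK.aestronglyMeasurable.mul
      (hw.comp (by fun_prop : Continuous fun y : Rn n => (p.1, p.2 - y))).aestronglyMeasurable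
  · intro p
    refine Eventually.of_forall fun y => ?_
    rw [Real.norm_eq_abs, abs_mul]
    exact mul_le_mul_of_nonneg_left (hb _) (abs_nonneg _)
  · exact hK.abs.mul_const C
  · refine Eventually.of_forall fun y => ?_
    exact continuous_const.mul
      (hw.comp (by fun_prop : Continuous fun p : ℝ × Rn n => (p.1, p.2 - y)))

/-- The bracket in the definition of `Pop`. -/
def Br {n : ℕ} (J : Rn n → ℝ) (β τ η₀ : ℝ) (d b : ℝ → ℝ) (u : ℝ → Rn n → ℝ) (s : ℝ) (x : Rn n) : ℝ :=
  (∫ y : Rn n, J (x - y) * u s y) + (η₀ - 1) * u s x - d (u s x)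
          + ∫ y : Rn n, heatKernel n β y * b (u (s - τ) (x - y))

theorem slice_cont {n : ℕ} {τ T uplus : ℝ} {u₀ u : ℝ → Rn n → ℝ} (hu : Bmem τ T uplus u₀ u)
    {t : ℝ} (ht : t ∈ Icc (-τ) T) : Continuous (u t) :=
  hu.1.comp_continuous (by fun_prop : Continuous fun x : Rn n => (t, x)) (fun x => ⟨ht, mem_univ _⟩)

theorem Br_cont {n : ℕ} {J : Rn n → ℝ} {β τ T uplus η₀ : ℝ} {d b : ℝ → ℝ} {u₀ u : ℝ → Rn n → ℝ}
    (hu : Bmem τ T uplus u₀ u) (hτ : 0 ≤ τ) (hT : 0 < T) (hβ : 0 < β) (huplus : 0 < uplus)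
    (hJint : Integrable J)
    (hd : ContinuousOn d (Icc 0 uplus)) (hb : ContinuousOn b (Icc 0 uplus)) :
    ∃ G : ℝ × Rn n → ℝ, Continuous G ∧ ∀ s ∈ Icc 0 T, ∀ x, Br J β τ η₀ d b u s x = G (s, x) := by
  have hle : -τ ≤ T := by linarith
  let U : ℝ × Rn n → ℝ := fun p => u (projIcc (-τ) T hle p.1) p.2
  have hUc : Continuous U := by
    refine hu.1.comp_continuous (f := fun p : ℝ × Rn n => (((projIcc (-τ) T hle p.1 : Icc (-τ) T) : ℝ), p.2)) ?_ ?_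
    · exact ((continuous_subtype_val.comp (continuous_projIcc.comp continuous_fst))).prodMk continuous_snd
    · intro p
      exact ⟨(projIcc (-τ) T hle p.1).2, mem_univ _⟩
  have hUm : ∀ p, U p ∈ Icc 0 uplus := fun p => hu.2.1 _ (projIcc (-τ) T hle p.1).2 _
  have hUe : ∀ t ∈ Icc (-τ) T, ∀ x, U (t, x) = u t x := by
    intro t ht x
    simp only [U]
    rw [projIcc_of_mem hle ht]
  have hdU : Continuous (fun p => d (U p)) := hd.comp_continuous hUc hUm
  have hbU : Continuous (fun p => b (U p)) := hb.comp_continuous hUc hUm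
  obtain ⟨C, hC⟩ := isCompact_Icc.exists_bound_of_continuousOn hb
  have c1 := conv_cont (C := uplus) hJint hUc (fun p => by
    rw [abs_of_nonneg (hUm p).1]; exact (hUm p).2)
  have c2 := conv_cont (C := C) (hk_integrable (n := n) hβ) hbU (fun p => hC _ (hUm p))
  refine ⟨fun p => (∫ y, J y * U (p.1, p.2 - y)) + (η₀ - 1) * U p - d (U p)
    + ∫ y, heatKernel n β y * b (U (p.1 - τ, p.2 - y)), ?_, ?_⟩
  · refine ((c1.add (continuous_const.mul hUc)).sub hdU).add ?_
    exact c2.comp (by fun_prop : Continuous fun p : ℝ × Rn n => (p.1 - τ, p.2))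
  · intro s hs x
    have m1 : s ∈ Icc (-τ) T := ⟨by linarith [hs.1], hs.2⟩
    have m2 : s - τ ∈ Icc (-τ) T := ⟨by linarith [hs.1], by linarith [hs.2]⟩
    simp only [Br, hUe _ m1, hUe _ m2]
    congr 3
    have := integral_sub_left_eq_self (fun y => J (x - y) * u s y) (volume : Measure (Rn n)) x
    rw [← this]
    simp

theorem int_exp_s12 {η : ℝ} (hη : 0 < η) (t : ℝ) :
    (∫ s in (0:ℝ)..t, rexp (-η * (t - s))) = (1 - rexp (-η * t)) / η := by
  have hd : ∀ s ∈ uIcc 0 t, HasDerivAt (fun s => rexp (-η * (t - s)) / η) (rexp (-η * (t - s))) s := by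
    intro s _
    have h1 : HasDerivAt (fun s => -η * (t - s)) (-η * (-1)) s :=
      ((hasDerivAt_id s).const_sub t).const_mul (-η)
    have := (h1.exp).div_const η
    have e : rexp (-η * (t - s)) * (-η * -1) / η = rexp (-η * (t - s)) := by
      field_simp
    rwa [e] at this
  rw [intervalIntegral.integral_eq_sub_of_hasDerivAt hd]
  · simp; ring
  · exact (by fun_prop : Continuous fun s => rexp (-η * (t - s))).intervalIntegrable _ _

theorem Pop_eq {n : ℕ} {J : Rn n → ℝ} {β τ T uplus η₀ : ℝ} {d b : ℝ → ℝ} {u₀ u : ℝ → Rn n → ℝ}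
    {G : ℝ × Rn n → ℝ} (hG : ∀ s ∈ Icc 0 T, ∀ x, Br J β τ η₀ d b u s x = G (s, x))
    {t : ℝ} (ht : t ∈ Icc 0 T) (x : Rn n) :
    Pop J β τ η₀ d b u₀ u t x = rexp (-η₀ * t) * u₀ 0 x
      + ∫ s in (0:ℝ)..t, rexp (-η₀ * (t - s)) * G (s, x) := by
  unfold Pop
  rw [if_neg (not_lt.2 ht.1)]
  congr 1
  refine intervalIntegral.integral_congr fun s hs => ?_
  rw [uIcc_of_le ht.1] at hs
  have := hG s ⟨hs.1, hs.2.trans ht.2⟩ x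
  simp only [Br] at this
  simp only [this]

theorem Pop_mem {n : ℕ} {J : Rn n → ℝ} {β τ T uplus η₀ : ℝ} {d b : ℝ → ℝ} {u₀ u : ℝ → Rn n → ℝ}
    (hu : Bmem τ T uplus u₀ u) (hτ : 0 ≤ τ) (hT : 0 < T) (hη : 0 < η₀)
    (hu₀cont : ContinuousOn (fun p : ℝ × Rn n => u₀ p.1 p.2) (Set.Icc (-τ) 0 ×ˢ Set.univ))
    (hu₀bd : ∀ s ∈ Set.Icc (-τ) 0, ∀ x : Rn n, 0 ≤ u₀ s x ∧ u₀ s x ≤ uplus)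
    {G : ℝ × Rn n → ℝ} (hGc : Continuous G)
    (hG : ∀ s ∈ Icc 0 T, ∀ x, Br J β τ η₀ d b u s x = G (s, x))
    (hGb : ∀ s ∈ Icc 0 T, ∀ x, 0 ≤ G (s, x) ∧ G (s, x) ≤ η₀ * uplus) :
    Bmem τ T uplus u₀ (Pop J β τ η₀ d b u₀ u) := by
  have z0 : (0:ℝ) ∈ Icc (-τ) 0 := ⟨by linarith, le_rfl⟩
  have hle : ∀ s ∈ Icc (-τ) 0, ∀ x, Pop J β τ η₀ d b u₀ u s x = u₀ s x := by
    intro s hs x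
    rcases lt_or_eq_of_le hs.2 with h | h
    · unfold Pop; rw [if_pos h]
    · subst h; simp [Pop]
  refine ⟨?_, ?_, hle⟩
  · have hA : ContinuousOn (fun p : ℝ × Rn n => Pop J β τ η₀ d b u₀ u p.1 p.2)
        (Icc (-τ) 0 ×ˢ univ) := hu₀cont.congr fun p hp => hle p.1 hp.1 p.2
    have hB : ContinuousOn (fun p : ℝ × Rn n => Pop J β τ η₀ d b u₀ u p.1 p.2)
        (Icc 0 T ×ˢ univ) := by
      have hc : Continuous (fun p : ℝ × Rn n => rexp (-η₀ * p.1) * u₀ 0 p.2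
          + ∫ s in (0:ℝ)..p.1, rexp (-η₀ * (p.1 - s)) * G (s, p.2)) := by
        have h0 : Continuous (u₀ 0) := hu₀cont.comp_continuous
          (by fun_prop : Continuous fun x : Rn n => ((0:ℝ), x)) (fun x => ⟨z0, mem_univ _⟩)
        refine Continuous.add (by fun_prop) ?_
        refine intervalIntegral.continuous_parametric_intervalIntegral_of_continuous
          (f := fun (p : ℝ × Rn n) s => rexp (-η₀ * (p.1 - s)) * G (s, p.2)) ?_ continuous_fst
        simp only [Function.uncurry_def]
        fun_prop
      exact hc.continuousOn.congr fun p hp => Pop_eq (uplus := uplus) hG hp.1 p.2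
    have := hA.union_of_isClosed hB (isClosed_Icc.prod isClosed_univ)
      (isClosed_Icc.prod isClosed_univ)
    rwa [← union_prod, Icc_union_Icc_eq_Icc (by linarith) hT.le] at this
  · intro t ht x
    rcases le_total t 0 with h | h
    · rw [hle t ⟨ht.1, h⟩]; exact hu₀bd t ⟨ht.1, h⟩ x
    · rw [Pop_eq (uplus := uplus) hG ⟨h, ht.2⟩ x]
      obtain ⟨a, c⟩ := hu₀bd 0 z0 x
      have e0 := (Real.exp_pos (-η₀ * t)).le
      constructor
      · refine add_nonneg (mul_nonneg e0 a) (intervalIntegral.integral_nonneg h fun s hs => ?_)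
        exact mul_nonneg (Real.exp_pos _).le (hGb s ⟨hs.1, hs.2.trans ht.2⟩ x).1
      · have : (∫ s in (0:ℝ)..t, rexp (-η₀ * (t - s)) * G (s, x))
            ≤ ∫ s in (0:ℝ)..t, rexp (-η₀ * (t - s)) * (η₀ * uplus) := by
          refine intervalIntegral.integral_mono_on h
            ((by fun_prop : Continuous fun s => rexp (-η₀ * (t - s)) * G (s, x)).intervalIntegrable _ _)
            ((by fun_prop : Continuous fun s => rexp (-η₀ * (t - s)) * (η₀ * uplus)).intervalIntegrable _ _)
            fun s hs => ?_
          exact mul_le_mul_of_nonneg_left (hGb s ⟨hs.1, hs.2.trans ht.2⟩ x).2 (Real.exp_pos _).le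
        rw [intervalIntegral.integral_mul_const, int_exp_s12 hη] at this
        have e : (1 - rexp (-η₀ * t)) / η₀ * (η₀ * uplus) = (1 - rexp (-η₀ * t)) * uplus := by
          field_simp
        rw [e] at this
        nlinarith [mul_le_mul_of_nonneg_left c e0]

theorem Bnorm_bound {n : ℕ} {τ T uplus η₀ : ℝ} {u₀ u₁ u₂ : ℝ → Rn n → ℝ}
    (hτ : 0 ≤ τ) (hη : 0 < η₀)
    (h₁ : Bmem τ T uplus u₀ u₁) (h₂ : Bmem τ T uplus u₀ u₂)
    {t : ℝ} (ht : t ∈ Icc 0 T) (x : Rn n) :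
    |u₁ t x - u₂ t x| ≤ rexp (η₀ * t) * Bnorm T η₀ (fun t x => u₁ t x - u₂ t x) := by
  have hb : ∀ t ∈ Icc 0 T, ∀ x, |u₁ t x - u₂ t x| ≤ uplus := by
    intro t ht x
    have m : t ∈ Icc (-τ) T := ⟨by linarith [ht.1], ht.2⟩
    have a := h₁.2.1 t m x
    have c := h₂.2.1 t m x
    rw [abs_le]; constructor <;> linarith
  have hB : BddAbove (range fun t : Icc (0:ℝ) T => rexp (-η₀ * (t:ℝ)) * ⨆ x : Rn n, |u₁ t x - u₂ t x|) := by
    refine ⟨uplus, ?_⟩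
    rintro _ ⟨s, rfl⟩
    have k : (⨆ x : Rn n, |u₁ s x - u₂ s x|) ≤ uplus := ciSup_le (hb s s.2)
    have k0 : 0 ≤ (⨆ x : Rn n, |u₁ s x - u₂ s x|) := Real.iSup_nonneg fun _ => abs_nonneg _
    have k1 : rexp (-η₀ * (s:ℝ)) ≤ 1 := Real.exp_le_one_iff.2 (by nlinarith [s.2.1])
    show rexp (-η₀ * (s:ℝ)) * _ ≤ uplus
    nlinarith
  have a1 := le_ciSup hB ⟨t, ht⟩
  have a2 : |u₁ t x - u₂ t x| ≤ ⨆ x : Rn n, |u₁ t x - u₂ t x| :=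
    le_ciSup (f := fun x => |u₁ t x - u₂ t x|) ⟨uplus, by rintro _ ⟨y, rfl⟩; exact hb t ht y⟩ x
  have a3 : rexp (-η₀ * t) * (⨆ x : Rn n, |u₁ t x - u₂ t x|)
    ≤ Bnorm T η₀ (fun t x => u₁ t x - u₂ t x) := a1
  refine a2.trans ?_
  have := mul_le_mul_of_nonneg_left a3 (Real.exp_pos (η₀ * t)).le
  rw [← mul_assoc, ← Real.exp_add] at this
  simpa using this

theorem Bnorm_nonneg {n : ℕ} {T η₀ : ℝ} (f : ℝ → Rn n → ℝ) : 0 ≤ Bnorm T η₀ f :=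
  Real.iSup_nonneg fun _ => mul_nonneg (Real.exp_pos _).le (Real.iSup_nonneg fun _ => abs_nonneg _)

theorem Pop_contr {n : ℕ} {J : Rn n → ℝ} {β τ T uplus η₀ N : ℝ} {d b : ℝ → ℝ}
    {u₀ u₁ u₂ : ℝ → Rn n → ℝ} (hT : 0 < T) (hη : 1 ≤ η₀) (hN : 0 ≤ N)
    {G₁ G₂ : ℝ × Rn n → ℝ} (hGc₁ : Continuous G₁) (hGc₂ : Continuous G₂)
    (hG₁ : ∀ s ∈ Icc 0 T, ∀ x, Br J β τ η₀ d b u₁ s x = G₁ (s, x))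
    (hG₂ : ∀ s ∈ Icc 0 T, ∀ x, Br J β τ η₀ d b u₂ s x = G₂ (s, x))
    (hd : ∀ s ∈ Icc 0 T, ∀ x, |G₁ (s, x) - G₂ (s, x)| ≤ (2 * η₀ - 1) * (rexp (η₀ * s) * N)) :
    Bnorm T η₀ (fun t x => Pop J β τ η₀ d b u₀ u₁ t x - Pop J β τ η₀ d b u₀ u₂ t x)
        ≤ (2 * η₀ - 1) / (2 * η₀) * N := by
  haveI : Nonempty (Icc (0:ℝ) T) := ⟨⟨0, le_rfl, hT.le⟩⟩
  refine ciSup_le ?_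
  rintro ⟨t, ht⟩
  have key : ∀ x : Rn n, |Pop J β τ η₀ d b u₀ u₁ t x - Pop J β τ η₀ d b u₀ u₂ t x|
      ≤ rexp (η₀ * t) * ((2 * η₀ - 1) / (2 * η₀) * N) := by
    intro x
    rw [Pop_eq (uplus := uplus) hG₁ ht x, Pop_eq (uplus := uplus) hG₂ ht x, add_sub_add_left_eq_sub,
      ← intervalIntegral.integral_sub
        ((by fun_prop : Continuous fun s => rexp (-η₀ * (t - s)) * G₁ (s, x)).intervalIntegrable _ _)
        ((by fun_prop : Continuous fun s => rexp (-η₀ * (t - s)) * G₂ (s, x)).intervalIntegrable _ _)]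
    have h1 : |∫ s in (0:ℝ)..t, (rexp (-η₀ * (t - s)) * G₁ (s, x) - rexp (-η₀ * (t - s)) * G₂ (s, x))|
        ≤ ∫ s in (0:ℝ)..t, rexp (-(2 * η₀) * (t - s)) * (rexp (η₀ * t) * ((2 * η₀ - 1) * N)) := by
      refine (intervalIntegral.abs_integral_le_integral_abs ht.1).trans ?_
      refine intervalIntegral.integral_mono_on ht.1
        ((by fun_prop : Continuous fun s => |rexp (-η₀ * (t - s)) * G₁ (s, x) - rexp (-η₀ * (t - s)) * G₂ (s, x)|).intervalIntegrable _ _)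
        ((by fun_prop : Continuous fun s => rexp (-(2 * η₀) * (t - s)) * (rexp (η₀ * t) * ((2 * η₀ - 1) * N))).intervalIntegrable _ _)
        fun s hs => ?_
      rw [← mul_sub, abs_mul, abs_of_pos (Real.exp_pos _)]
      refine (mul_le_mul_of_nonneg_left (hd s ⟨hs.1, hs.2.trans ht.2⟩ x) (Real.exp_pos _).le).trans ?_
      apply le_of_eq
      have : rexp (-η₀ * (t - s)) * rexp (η₀ * s) = rexp (-(2 * η₀) * (t - s)) * rexp (η₀ * t) := by
        rw [← Real.exp_add, ← Real.exp_add]; congr 1; ring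
      calc _ = (rexp (-η₀ * (t - s)) * rexp (η₀ * s)) * ((2 * η₀ - 1) * N) := by ring
        _ = _ := by rw [this]; ring
    refine h1.trans ?_
    rw [intervalIntegral.integral_mul_const, int_exp_s12 (by linarith)]
    have e0 := Real.exp_pos (-(2 * η₀) * t)
    have e1 : (1 - rexp (-(2 * η₀) * t)) / (2 * η₀) ≤ 1 / (2 * η₀) := by
      gcongr
      linarith
    have e2 : 0 ≤ rexp (η₀ * t) * ((2 * η₀ - 1) * N) :=
      mul_nonneg (Real.exp_pos _).le (mul_nonneg (by linarith) hN)
    refine (mul_le_mul_of_nonneg_right e1 e2).trans (le_of_eq (by ring))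
  have k := mul_le_mul_of_nonneg_left (ciSup_le key) (Real.exp_pos (-η₀ * t)).le
  rw [← mul_assoc, ← Real.exp_add] at k
  simpa using k

theorem lip_of {f f' : ℝ → ℝ} {uplus C : ℝ} (hf : ∀ u ∈ Icc 0 uplus, HasDerivAt f (f' u) u)
    (hb : ∀ u ∈ Icc 0 uplus, 0 ≤ f' u ∧ f' u ≤ C) {x y : ℝ} (hx : x ∈ Icc 0 uplus)
    (hy : y ∈ Icc 0 uplus) : |f x - f y| ≤ C * |x - y| :=
  Convex.norm_image_sub_le_of_norm_hasDerivWithin_le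
    (fun u hu => (hf u hu).hasDerivWithinAt)
    (fun u hu => by rw [Real.norm_eq_abs, abs_of_nonneg (hb u hu).1]; exact (hb u hu).2)
    (convex_Icc 0 uplus) hy hx

theorem mono_of {f f' : ℝ → ℝ} {uplus : ℝ} (hf : ∀ u ∈ Icc 0 uplus, HasDerivAt f (f' u) u)
    (hb : ∀ u ∈ Icc 0 uplus, 0 ≤ f' u) : MonotoneOn f (Icc 0 uplus) := by
  refine monotoneOn_of_deriv_nonneg (convex_Icc _ _)
    (fun u hu => (hf u hu).continuousAt.continuousWithinAt)
    (fun u hu => (hf u (interior_subset hu)).differentiableAt.differentiableWithinAt) fun u hu => ?_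
  rw [(hf u (interior_subset hu)).deriv]
  exact hb u (interior_subset hu)

/-- the operator `𝒫` maps `𝔅` into `𝔅` and is a contraction with
constant `(2η₀-1)/(2η₀)`. -/
theorem Pop_contraction {n : ℕ} [NeZero n]
    (d b d' b' d'' b'' : ℝ → ℝ) (uplus : ℝ)
    -- (H1)
    (huplus : 0 < uplus) (hd0 : d 0 = 0) (hb0 : b 0 = 0) (hdbu : d uplus = b uplus)
    (hd'def : ∀ u ∈ Set.Icc 0 uplus, HasDerivAt d (d' u) u)
    (hb'def : ∀ u ∈ Set.Icc 0 uplus, HasDerivAt b (b' u) u)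
    (hd''def : ∀ u ∈ Set.Icc 0 uplus, HasDerivAt d' (d'' u) u)
    (hb''def : ∀ u ∈ Set.Icc 0 uplus, HasDerivAt b' (b'' u) u)
    (hd''cont : ContinuousOn d'' (Set.Icc 0 uplus))
    (hb''cont : ContinuousOn b'' (Set.Icc 0 uplus))
    -- (H2)
    (h2a : d' 0 < b' 0) (h2b : 0 ≤ d' 0) (h2c : 0 ≤ b' uplus) (h2d : b' uplus < d' uplus)
    -- (H3)
    (h3 : ∀ u ∈ Set.Icc 0 uplus, 0 ≤ d' u ∧ 0 ≤ b' u ∧ 0 ≤ d'' u ∧ b'' u ≤ 0)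
    (J : Rn n → ℝ) (hJ0 : ∀ y, 0 ≤ J y) (hJint : Integrable J)
    (hJ1 : (∫ y : Rn n, J y) = 1)
    (τ β T : ℝ) (hτ : 0 ≤ τ) (hβ : 0 < β) (hT : 0 < T)
    (u₀ : ℝ → Rn n → ℝ)
    (hu₀cont : ContinuousOn (fun p : ℝ × Rn n => u₀ p.1 p.2) (Set.Icc (-τ) 0 ×ˢ Set.univ))
    (hu₀bd : ∀ s ∈ Set.Icc (-τ) 0, ∀ x : Rn n, 0 ≤ u₀ s x ∧ u₀ s x ≤ uplus)
    (η₁ η₂ η₀ : ℝ)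
    (hη₁ : η₁ = sSup ((fun u => |d' u|) '' Set.Icc 0 uplus))
    (hη₂ : η₂ = sSup ((fun u => |b' u|) '' Set.Icc 0 uplus))
    (hη₀ : η₀ = 1 + η₁ + η₂) :
    (∀ u : ℝ → Rn n → ℝ, Bmem τ T uplus u₀ u →
      Bmem τ T uplus u₀ (Pop J β τ η₀ d b u₀ u)) ∧
    (∀ u₁ u₂ : ℝ → Rn n → ℝ, Bmem τ T uplus u₀ u₁ → Bmem τ T uplus u₀ u₂ →
      Bnorm T η₀ (fun t x => Pop J β τ η₀ d b u₀ u₁ t x - Pop J β τ η₀ d b u₀ u₂ t x)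
        ≤ (2 * η₀ - 1) / (2 * η₀) * Bnorm T η₀ (fun t x => u₁ t x - u₂ t x)) := by
  have hdc : ContinuousOn d (Icc 0 uplus) := fun u hu => (hd'def u hu).continuousAt.continuousWithinAt
  have hbc : ContinuousOn b (Icc 0 uplus) := fun u hu => (hb'def u hu).continuousAt.continuousWithinAt
  have hd'c : ContinuousOn d' (Icc 0 uplus) := fun u hu => (hd''def u hu).continuousAt.continuousWithinAt
  have hb'c : ContinuousOn b' (Icc 0 uplus) := fun u hu => (hb''def u hu).continuousAt.continuousWithinAt
  have l1 : ∀ u ∈ Icc 0 uplus, d' u ≤ η₁ := fun u hu => by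
    rw [hη₁]
    exact (le_abs_self _).trans (le_csSup (isCompact_Icc.image_of_continuousOn hd'c.abs).bddAbove
      ⟨u, hu, rfl⟩)
  have l2 : ∀ u ∈ Icc 0 uplus, b' u ≤ η₂ := fun u hu => by
    rw [hη₂]
    exact (le_abs_self _).trans (le_csSup (isCompact_Icc.image_of_continuousOn hb'c.abs).bddAbove
      ⟨u, hu, rfl⟩)
  have z : (0:ℝ) ∈ Icc 0 uplus := ⟨le_rfl, huplus.le⟩
  have zu : uplus ∈ Icc 0 uplus := ⟨huplus.le, le_rfl⟩
  have p1 : 0 ≤ η₁ := h2b.trans (l1 0 z)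
  have p2 : 0 ≤ η₂ := (h3 0 z).2.1.trans (l2 0 z)
  have hη : 1 ≤ η₀ := by linarith
  -- the function `g`
  have hg : ∀ u ∈ Icc 0 uplus, HasDerivAt (fun u => (η₀ - 1) * u - d u) ((η₀ - 1) - d' u) u := by
    intro u hu
    have := ((hasDerivAt_id u).const_mul (η₀ - 1)).sub (hd'def u hu)
    simpa using! this
  have hgb : ∀ u ∈ Icc 0 uplus, 0 ≤ (η₀ - 1) - d' u ∧ (η₀ - 1) - d' u ≤ η₀ - 1 := by
    intro u hu
    have := l1 u hu
    have := (h3 u hu).1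
    constructor <;> linarith
  have hgm := mono_of hg (fun u hu => (hgb u hu).1)
  have hbm := mono_of hb'def (fun u hu => (h3 u hu).2.1)
  have hgl : ∀ x ∈ Icc 0 uplus, ∀ y ∈ Icc 0 uplus, |((η₀ - 1) * x - d x) - ((η₀ - 1) * y - d y)|
      ≤ (η₀ - 1) * |x - y| := fun x hx y hy => lip_of hg hgb hx hy
  have hbl : ∀ x ∈ Icc 0 uplus, ∀ y ∈ Icc 0 uplus, |b x - b y| ≤ η₂ * |x - y| :=
    fun x hx y hy => lip_of hb'def (fun u hu => ⟨(h3 u hu).2.1, l2 u hu⟩) hx hy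
  have hbr : ∀ x ∈ Icc 0 uplus, 0 ≤ b x ∧ b x ≤ b uplus := fun x hx =>
    ⟨hb0 ▸ hbm z hx hx.1, hbm hx zu hx.2⟩
  have JK : ∀ x : Rn n, Integrable (fun y => J (x - y)) ∧ (∫ y, J (x - y)) = 1 := fun x =>
    ⟨hJint.comp_sub_left x, by rw [integral_sub_left_eq_self J volume x, hJ1]⟩
  have ms : ∀ s ∈ Icc 0 T, s ∈ Icc (-τ) T ∧ s - τ ∈ Icc (-τ) T := fun s hs =>
    ⟨⟨by linarith [hs.1], hs.2⟩, ⟨by linarith [hs.1], by linarith [hs.2]⟩⟩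
  have bcont : ∀ u, Bmem τ T uplus u₀ u → ∀ s ∈ Icc 0 T, ∀ x,
      Continuous (fun y => b (u (s - τ) (x - y))) := by
    intro u hu s hs x
    refine hbc.comp_continuous ((slice_cont hu (ms s hs).2).comp (by fun_prop)) fun y => ?_
    exact hu.2.1 _ (ms s hs).2 _
  constructor
  · intro u hu
    obtain ⟨G, hGc, hG⟩ := Br_cont (J := J) (η₀ := η₀) hu hτ hT hβ huplus hJint hdc hbc
    refine Pop_mem hu hτ hT (by linarith) hu₀cont hu₀bd hGc hG fun s hs x => ?_
    rw [← hG s hs x, Br]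
    obtain ⟨m1, m2⟩ := ms s hs
    have a1 := avg_bounds (JK x).1 (fun y => hJ0 _) (JK x).2 (slice_cont hu m1)
      (fun y => (hu.2.1 s m1 y).1) (fun y => (hu.2.1 s m1 y).2)
    have a2 := avg_bounds (hk_integrable (n := n) hβ) (hk_nonneg hβ) (hk_int hβ) (bcont u hu s hs x)
      (fun y => (hbr _ (hu.2.1 _ m2 _)).1) (fun y => (hbr _ (hu.2.1 _ m2 _)).2)
    have a3 := hgm z (hu.2.1 s m1 x) (hu.2.1 s m1 x).1
    have a4 := hgm (hu.2.1 s m1 x) zu (hu.2.1 s m1 x).2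
    simp only [hd0] at a3 a4
    constructor <;> linarith [a1.1, a1.2, a2.1, a2.2]
  · intro u₁ u₂ hu₁ hu₂
    obtain ⟨G₁, hGc₁, hG₁⟩ := Br_cont (J := J) (η₀ := η₀) hu₁ hτ hT hβ huplus hJint hdc hbc
    obtain ⟨G₂, hGc₂, hG₂⟩ := Br_cont (J := J) (η₀ := η₀) hu₂ hτ hT hβ huplus hJint hdc hbc
    have hN := Bnorm_nonneg (T := T) (η₀ := η₀) (fun t x => u₁ t x - u₂ t x)
    have hNb : ∀ t ∈ Icc 0 T, ∀ x, |u₁ t x - u₂ t x| ≤ _ := fun t ht x =>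
      Bnorm_bound (η₀ := η₀) hτ (by linarith) hu₁ hu₂ ht x
    set N := Bnorm T η₀ (fun t x => u₁ t x - u₂ t x) with hNdef
    refine Pop_contr (uplus := uplus) hT hη hN hGc₁ hGc₂ hG₁ hG₂ fun s hs x => ?_
    rw [← hG₁ s hs x, ← hG₂ s hs x, Br, Br]
    obtain ⟨m1, m2⟩ := ms s hs
    set E := rexp (η₀ * s) * N with hE
    have hE0 : 0 ≤ E := mul_nonneg (Real.exp_pos _).le hN
    have ab : ∀ u, Bmem τ T uplus u₀ u → ∀ y, |u s y| ≤ uplus := fun u hu y => by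
      rw [abs_of_nonneg (hu.2.1 s m1 y).1]; exact (hu.2.1 s m1 y).2
    have abb : ∀ u, Bmem τ T uplus u₀ u → ∀ y, |b (u (s - τ) (x - y))| ≤ b uplus := fun u hu y => by
      have := hbr _ (hu.2.1 _ m2 (x - y))
      rw [abs_of_nonneg this.1]; exact this.2
    have a1 := avg_diff (JK x).1 (fun y => hJ0 _) (JK x).2 (slice_cont hu₁ m1) (slice_cont hu₂ m1)
      (ab u₁ hu₁) (ab u₂ hu₂) (hNb s hs)
    have del : ∀ y, |u₁ (s - τ) y - u₂ (s - τ) y| ≤ E := by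
      intro y
      rcases le_total (s - τ) 0 with h | h
      · rw [hu₁.2.2 _ ⟨m2.1, h⟩, hu₂.2.2 _ ⟨m2.1, h⟩]; simpa using hE0
      · refine (hNb _ ⟨h, m2.2⟩ y).trans ?_
        refine mul_le_mul_of_nonneg_right (Real.exp_le_exp.2 ?_) hN
        nlinarith
    have a2 := avg_diff (E := η₂ * E) (hk_integrable (n := n) hβ) (hk_nonneg hβ) (hk_int hβ)
      (bcont u₁ hu₁ s hs x) (bcont u₂ hu₂ s hs x) (abb u₁ hu₁) (abb u₂ hu₂)
      (fun y => (hbl _ (hu₁.2.1 _ m2 _) _ (hu₂.2.1 _ m2 _)).trans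
        (mul_le_mul_of_nonneg_left (del _) p2))
    have a3 := (hgl _ (hu₁.2.1 s m1 x) _ (hu₂.2.1 s m1 x)).trans
      (mul_le_mul_of_nonneg_left (hNb s hs x) (by linarith))
    have a4 : (1 + (η₀ - 1) + η₂) * E ≤ (2 * η₀ - 1) * E :=
      mul_le_mul_of_nonneg_right (by linarith) hE0
    rw [abs_le] at a1 a2 a3 ⊢
    constructor <;> linarith [a1.1, a1.2, a2.1, a2.2, a3.1, a3.2]

end
end

section
/- Assume (H1)-(H3), let J:ℝⁿ→ℝ be nonnegative and integrable with ∫_{ℝⁿ}J=1, let τ≥0 and β>0. Let ū and u̲ be continuous functions from [−τ,∞)×ℝⁿ to [u₋,u₊], continuously differentiable in t on (0,∞), such that for all t>0, x∈ℝⁿ: ∂_t ū − (J∗ū) + ū + d(ū(t,x)) ≥ ∫_{ℝⁿ} f_β(y) b(ū(t−τ,x−y)) dy and ∂_t u̲ − (J∗u̲) + u̲ + d(u̲(t,x)) ≤ ∫_{ℝⁿ} f_β(y) b(u̲(t−τ,x−y)) dy, and such that u̲(s,x) ≤ ū(s,x) for all (s,x)∈[−τ,0]×ℝⁿ. Then u̲(t,x)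 ≤ ū(t,x) for all (t,x)∈[0,∞)×ℝⁿ. -/
open MeasureTheory Real Set Filter Asymptotics

noncomputable section

lemma aux_int {n : ℕ} (k g h : Rn n → ℝ) (c M : ℝ) (hk : Integrable k) (hk0 : ∀ y, 0 ≤ k y)
    (hg : Continuous g) (hh : Continuous h) (hgM : ∀ y, |g y| ≤ M) (hhM : ∀ y, |h y| ≤ M)
    (hgh : ∀ y, g y - h y ≤ c) :
    (∫ y, k y * g y) - (∫ y, k y * h y) ≤ c * ∫ y, k y := by
  have ig : Integrable (fun y => k y * g y) :=
    hk.mul_bdd (c := M) hg.aestronglyMeasurable (Eventually.of_forall fun y => hgM y)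
  have ih : Integrable (fun y => k y * h y) :=
    hk.mul_bdd (c := M) hh.aestronglyMeasurable (Eventually.of_forall fun y => hhM y)
  rw [← integral_sub ig ih, ← integral_const_mul]
  refine integral_mono (ig.sub ih) (hk.const_mul c) fun y => ?_
  have := mul_le_mul_of_nonneg_left (hgh y) (hk0 y)
  simp only
  linarith

lemma aux_heat {n : ℕ} (β : ℝ) (hβ : 0 < β) : Integrable (heatKernel n β) := by
  have h := GaussianFourier.integrable_cexp_neg_mul_sq_norm_add (V := Rn n)
    (b := ((1 / (4 * β) : ℝ) : ℂ)) (by rw [Complex.ofReal_re]; positivity) 0 0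
  have h2 := h.norm
  unfold heatKernel
  refine Integrable.const_mul ?_ _
  refine h2.congr (Eventually.of_forall fun y => ?_)
  simp only [Complex.norm_exp]
  congr 1
  have : (-((1 / (4 * β) : ℝ) : ℂ) * (‖y‖ : ℂ) ^ 2 + 0 * ((inner ℝ (0 : Rn n) y : ℝ) : ℂ))
      = ((-‖y‖ ^ 2 / (4 * β) : ℝ) : ℂ) := by
    push_cast; ring
  rw [this, Complex.ofReal_re]

lemma aux_ode (φ φ' : ℝ → ℝ) (K A : ℝ) (hK : 0 < K) (hA : 0 < A)
    (hc : ContinuousOn φ (Ici 0)) (h0 : φ 0 ≤ 0) (hd : ∀ t > 0, HasDerivAt φ (φ' t) t)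
    (hb : ∀ t > 0, 0 < φ t → φ' t ≤ K * (A * exp (4 * K * t))) :
    ∀ t ≥ 0, φ t ≤ A / 2 * exp (4 * K * t) := by
  intro t ht
  set B : ℝ → ℝ := fun t => A / 2 * exp (4 * K * t) with hB
  have hBpos : ∀ s, 0 < B s := fun s => by positivity
  have hBc : Continuous B := by fun_prop
  have hBd : ∀ s, HasDerivAt B (A / 2 * (exp (4 * K * s) * (4 * K))) s := by
    intro s
    have : HasDerivAt (fun s : ℝ => 4 * K * s) (4 * K) s := by
      simpa using (hasDerivAt_id s).const_mul (4 * K)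
    exact (this.exp).const_mul _
  change φ t ≤ B t
  rcases eq_or_lt_of_le ht with h | h
  · subst h; exact h0.trans (hBpos 0).le
  have hev : ∀ᶠ s in nhdsWithin (0 : ℝ) (Ici 0), φ s < B s :=
    (hc 0 self_mem_Ici).eventually_lt hBc.continuousWithinAt (h0.trans_lt (hBpos 0))
  have hev2 : ∀ᶠ s in nhdsWithin (0 : ℝ) (Ioi 0), φ s < B s ∧ s ∈ Ioo 0 t :=
    (hev.filter_mono (nhdsWithin_mono _ Ioi_subset_Ici_self)).and (Ioo_mem_nhdsGT h)
  obtain ⟨e, he, he0, het⟩ := hev2.exists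
  refine image_le_of_deriv_right_lt_deriv_boundary' (a := e) (b := t) (f' := φ')
    (hc.mono fun s hs => he0.le.trans hs.1)
    (fun s hs => (hd s (he0.trans_le hs.1)).hasDerivWithinAt) he.le hBc.continuousOn
    (fun s _ => (hBd s).hasDerivWithinAt) ?_ ⟨het.le, le_rfl⟩
  intro s hs hsB
  have := hb s (he0.trans_le hs.1) (hsB ▸ hBpos s)
  have : 0 < K * A * exp (4 * K * s) := by positivity
  nlinarith

/-- comparison principle: an upper solution dominates a lower
solution for all positive time, provided it does so initially. -/
theorem comparison_principle {n : ℕ} [NeZero n]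
    (d b d' b' d'' b'' : ℝ → ℝ) (uplus : ℝ)
    -- (H1)
    (huplus : 0 < uplus) (hd0 : d 0 = 0) (hb0 : b 0 = 0) (hdbu : d uplus = b uplus)
    (hd'def : ∀ u ∈ Set.Icc 0 uplus, HasDerivAt d (d' u) u)
    (hb'def : ∀ u ∈ Set.Icc 0 uplus, HasDerivAt b (b' u) u)
    (hd''def : ∀ u ∈ Set.Icc 0 uplus, HasDerivAt d' (d'' u) u)
    (hb''def : ∀ u ∈ Set.Icc 0 uplus, HasDerivAt b' (b'' u) u)
    (hd''cont : ContinuousOn d'' (Set.Icc 0 uplus))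
    (hb''cont : ContinuousOn b'' (Set.Icc 0 uplus))
    -- (H2)
    (h2a : d' 0 < b' 0) (h2b : 0 ≤ d' 0) (h2c : 0 ≤ b' uplus) (h2d : b' uplus < d' uplus)
    -- (H3)
    (h3 : ∀ u ∈ Set.Icc 0 uplus, 0 ≤ d' u ∧ 0 ≤ b' u ∧ 0 ≤ d'' u ∧ b'' u ≤ 0)
    (J : Rn n → ℝ) (hJ0 : ∀ y, 0 ≤ J y) (hJint : Integrable J)
    (hJ1 : (∫ y : Rn n, J y) = 1)
    (τ β : ℝ) (hτ : 0 ≤ τ) (hβ : 0 < β)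
    (ubar ulow ubart ulowt : ℝ → Rn n → ℝ)
    (hubarcont : ContinuousOn (fun p : ℝ × Rn n => ubar p.1 p.2) (Set.Ici (-τ) ×ˢ Set.univ))
    (hulowcont : ContinuousOn (fun p : ℝ × Rn n => ulow p.1 p.2) (Set.Ici (-τ) ×ˢ Set.univ))
    (hubarbd : ∀ t ≥ -τ, ∀ x : Rn n, 0 ≤ ubar t x ∧ ubar t x ≤ uplus)
    (hulowbd : ∀ t ≥ -τ, ∀ x : Rn n, 0 ≤ ulow t x ∧ ulow t x ≤ uplus)
    (hubart : ∀ t > (0 : ℝ), ∀ x : Rn n, HasDerivAt (fun t => ubar t x) (ubart t x) t)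
    (hulowt : ∀ t > (0 : ℝ), ∀ x : Rn n, HasDerivAt (fun t => ulow t x) (ulowt t x) t)
    (hubartc : ∀ x : Rn n, ContinuousOn (fun t => ubart t x) (Set.Ioi 0))
    (hulowtc : ∀ x : Rn n, ContinuousOn (fun t => ulowt t x) (Set.Ioi 0))
    (hupper : ∀ t > (0 : ℝ), ∀ x : Rn n,
      (∫ y : Rn n, heatKernel n β y * b (ubar (t - τ) (x - y)))
        ≤ ubart t x - (∫ y : Rn n, J (x - y) * ubar t y) + ubar t x + d (ubar t x))
    (hlower : ∀ t > (0 : ℝ), ∀ x : Rn n,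
      ulowt t x - (∫ y : Rn n, J (x - y) * ulow t y) + ulow t x + d (ulow t x)
        ≤ ∫ y : Rn n, heatKernel n β y * b (ulow (t - τ) (x - y)))
    (hinit : ∀ s ∈ Set.Icc (-τ) 0, ∀ x : Rn n, ulow s x ≤ ubar s x) :
    ∀ t ≥ (0 : ℝ), ∀ x : Rn n, ulow t x ≤ ubar t x := by
  have dmono : MonotoneOn d (Icc 0 uplus) := by
    refine monotoneOn_of_deriv_nonneg (convex_Icc _ _)
      (fun u hu => (hd'def u hu).continuousAt.continuousWithinAt) (fun u hu =>
      (hd'def u (interior_subset hu)).differentiableAt.differentiableWithinAt) fun u hu => ?_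
    rw [(hd'def u (interior_subset hu)).deriv]; exact (h3 u (interior_subset hu)).1
  have bcont : ContinuousOn b (Icc 0 uplus) :=
    fun u hu => (hb'def u hu).continuousAt.continuousWithinAt
  have bmono : MonotoneOn b (Icc 0 uplus) := by
    refine monotoneOn_of_deriv_nonneg (convex_Icc _ _) bcont (fun u hu =>
      (hb'def u (interior_subset hu)).differentiableAt.differentiableWithinAt) fun u hu => ?_
    rw [(hb'def u (interior_subset hu)).deriv]; exact (h3 u (interior_subset hu)).2.1
  obtain ⟨L, hL⟩ := isCompact_Icc.exists_bound_of_continuousOn (s := Icc 0 uplus) (f := b')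
    (fun u hu => (hb''def u hu).continuousAt.continuousWithinAt)
  have z0 : (0 : ℝ) ∈ Icc 0 uplus := ⟨le_rfl, huplus.le⟩
  have hL0 : 0 ≤ L := (norm_nonneg _).trans (hL 0 z0)
  obtain ⟨Mb, hMb⟩ := isCompact_Icc.exists_bound_of_continuousOn bcont
  have bLip : ∀ u ∈ Icc 0 uplus, ∀ v ∈ Icc 0 uplus, ∀ c, 0 ≤ c → u - v ≤ c →
      b u - b v ≤ L * c := by
    intro u hu v hv c hc huv
    rcases le_total u v with h | h
    · have := bmono hu hv h
      have : 0 ≤ L * c := by positivity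
      linarith
    · have h1 := Convex.norm_image_sub_le_of_norm_hasDerivWithin_le
        (fun w hw => (hb'def w hw).hasDerivWithinAt) hL (convex_Icc 0 uplus) hv hu
      rw [Real.norm_eq_abs, Real.norm_eq_abs, abs_of_nonneg (sub_nonneg.2 h)] at h1
      exact (le_abs_self _).trans (h1.trans (mul_le_mul_of_nonneg_left huv hL0))
  have hf := aux_heat (n := n) β hβ
  have hf0 : ∀ y, 0 ≤ heatKernel n β y := fun y => by unfold heatKernel; positivity
  set C := ∫ y, heatKernel n β y with hC
  have hC0 : 0 ≤ C := integral_nonneg hf0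
  set K := 1 + L * C with hKdef
  have hK : 0 < K := by positivity
  have sliceC : ∀ v : ℝ → Rn n → ℝ, ContinuousOn (fun p : ℝ × Rn n => v p.1 p.2)
      (Set.Ici (-τ) ×ˢ Set.univ) → ∀ t ≥ -τ, Continuous (v t) := by
    intro v hv t ht
    rw [← continuousOn_univ]
    exact hv.comp (f := fun x : Rn n => (t, x)) (by fun_prop) fun x _ => ⟨ht, mem_univ _⟩
  have sliceT : ∀ v : ℝ → Rn n → ℝ, ContinuousOn (fun p : ℝ × Rn n => v p.1 p.2)
      (Set.Ici (-τ) ×ˢ Set.univ) → ∀ x, ContinuousOn (fun t => v t x) (Ici 0) := by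
    intro v hv x
    refine hv.comp (f := fun t : ℝ => (t, x)) (by fun_prop) fun t ht => ⟨?_, mem_univ _⟩
    have : (0 : ℝ) ≤ t := ht
    change -τ ≤ t
    linarith
  have step : ∀ A > 0, (∀ t ≥ 0, ∀ x, ulow t x - ubar t x ≤ A * exp (4 * K * t)) →
      ∀ t ≥ 0, ∀ x, ulow t x - ubar t x ≤ A / 2 * exp (4 * K * t) := by
    intro A hA hyp t ht x
    refine aux_ode (fun t => ulow t x - ubar t x) (fun t => ulowt t x - ubart t x) K A hK hA
      ((sliceT ulow hulowcont x).sub (sliceT ubar hubarcont x))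
      (sub_nonpos.2 (hinit 0 ⟨by linarith, le_rfl⟩ x))
      (fun s hs => (hulowt s hs x).sub (hubart s hs x)) ?_ t ht
    intro s hs hpos
    have hsτ : s ≥ -τ := by linarith
    have hsd : s - τ ≥ -τ := by linarith
    set E := A * exp (4 * K * s) with hE
    have hE0 : 0 ≤ E := by positivity
    have hdel : ∀ y, ulow (s - τ) y - ubar (s - τ) y ≤ E := by
      intro y
      rcases le_total 0 (s - τ) with h | h
      · refine (hyp _ h y).trans ?_
        have : 4 * K * (s - τ) ≤ 4 * K * s := by nlinarith
        exact mul_le_mul_of_nonneg_left (exp_le_exp.2 this) hA.le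
      · exact (sub_nonpos.2 (hinit _ ⟨hsd, h⟩ y)).trans hE0
    have iJ : Integrable (fun y => J (x - y)) := hJint.comp_sub_left x
    have e1 := aux_int (fun y => J (x - y)) (ulow s) (ubar s) E uplus iJ (fun y => hJ0 _)
      (sliceC ulow hulowcont s hsτ) (sliceC ubar hubarcont s hsτ)
      (fun y => abs_le.2 ⟨by linarith [(hulowbd s hsτ y).1], (hulowbd s hsτ y).2⟩)
      (fun y => abs_le.2 ⟨by linarith [(hubarbd s hsτ y).1], (hubarbd s hsτ y).2⟩)
      (hyp s hs.le)
    rw [integral_sub_left_eq_self J volume x, hJ1] at e1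
    have bc : ∀ v : ℝ → Rn n → ℝ, ContinuousOn (fun p : ℝ × Rn n => v p.1 p.2)
        (Set.Ici (-τ) ×ˢ Set.univ) → (∀ t ≥ -τ, ∀ x : Rn n, 0 ≤ v t x ∧ v t x ≤ uplus) →
        Continuous (fun y => b (v (s - τ) (x - y))) := by
      intro v hv hvb
      refine bcont.comp_continuous ((sliceC v hv _ hsd).comp (by fun_prop)) fun y => ?_
      exact hvb _ hsd _
    have e2 := aux_int (heatKernel n β) (fun y => b (ulow (s - τ) (x - y)))
      (fun y => b (ubar (s - τ) (x - y))) (L * E) Mb hf hf0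
      (bc ulow hulowcont hulowbd) (bc ubar hubarcont hubarbd)
      (fun y => hMb _ (hulowbd _ hsd _)) (fun y => hMb _ (hubarbd _ hsd _))
      (fun y => bLip _ (hulowbd _ hsd _) _ (hubarbd _ hsd _) _ hE0 (hdel _))
    have e3 := dmono (hubarbd s hsτ x) (hulowbd s hsτ x) (sub_pos.1 hpos).le
    have e4 := hupper s hs x
    have e5 := hlower s hs x
    have e6 : K * E = E * 1 + L * E * C := by rw [hKdef]; ring
    rw [e6]
    linarith
  have all : ∀ k : ℕ, ∀ t ≥ 0, ∀ x, ulow t x - ubar t x ≤ uplus / 2 ^ k * exp (4 * K * t) := by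
    intro k
    induction k with
    | zero =>
      intro t ht x
      have h1 := (hulowbd t (by linarith) x).2
      have h2 := (hubarbd t (by linarith) x).1
      have : 1 ≤ exp (4 * K * t) := one_le_exp (by positivity)
      have : uplus * 1 ≤ uplus * exp (4 * K * t) := mul_le_mul_of_nonneg_left this huplus.le
      simp only [pow_zero, div_one]
      linarith
    | succ k ih =>
      have := step (uplus / 2 ^ k) (by positivity) ih
      intro t ht x
      refine (this t ht x).trans (le_of_eq ?_)
      rw [pow_succ]; field_simp
  intro t ht x
  have lim : Tendsto (fun k : ℕ => uplus / 2 ^ k * exp (4 * K * t)) atTop (nhds 0) := by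
    have h := (tendsto_pow_atTop_nhds_zero_of_lt_one (r := (1 / 2 : ℝ)) (by norm_num)
      (by norm_num)).const_mul (uplus * exp (4 * K * t))
    rw [mul_zero] at h
    refine h.congr fun k => ?_
    rw [one_div, inv_pow]; field_simp
  exact sub_nonpos.1 (ge_of_tendsto' lim fun k => all k t ht x)

end
end
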